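/- arXiv:0911.3712 — 2 statements merged into one kernel-verified Lean document; each statement's English description precedes it below -/
import Mathlib

section
/- For every constant c > 0 and every k ∈ ℕ there exists n₀ such that for all n ≥ n₀ and every integer ℓ with c·log₂ n ≤ ℓ ≤ n, every extension of P_cycl(ℓ,n) that is isometry-symmetric with respect to S_n (acting by permuting the nodes of K_n) has size greater than n^k. In particular, for c·log₂ n ≤ ℓ ≤ n there is no symmetric extended formulation of P_cycl(ℓ,n) of size polynomial in n. -/
open scoped BigOperators
open Classical in
noncomputable section

/-- Edges of the complete graph `K_n` on the node set `Fin n`. -/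
abbrev Edge (n : ℕ) := {e : Sym2 (Fin n) // ¬ e.IsDiag}

def edgeMap {n : ℕ} (π : Equiv.Perm (Fin n)) (e : Edge n) : Edge n :=
  ⟨Sym2.map π e.1, by rw [Sym2.isDiag_map (Equiv.injective π)]; exact e.2⟩

/-- Action of a node permutation on vectors indexed by edges:
`(π.x)_{{v,w}} = x_{{π⁻¹ v, π⁻¹ w}}`. -/
def edgeAction {n : ℕ} (π : Equiv.Perm (Fin n)) (x : Edge n → ℝ) : Edge n → ℝ :=
  fun e => x (edgeMap π⁻¹ e)

/-- Characteristic vector (on the edges of `K_n`) of the edge set of the simple cycle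
visiting the `ℓ` distinct nodes `f 0, f 1, …, f (ℓ-1)` in this cyclic order. -/
def cycleVec {n ℓ : ℕ} (f : Fin ℓ → Fin n) : Edge n → ℝ :=
  fun e =>
    if e.1 ∈ Finset.image (fun i : Fin ℓ => s(f i, f (finRotate ℓ i))) Finset.univ
    then 1 else 0

/-- `P_cycl(ℓ,n)`: convex hull of characteristic vectors of edge sets of length-`ℓ`
simple cycles in `K_n`. -/
def cyclePolytope (n ℓ : ℕ) : Set (Edge n → ℝ) :=
  convexHull ℝ {x | ∃ f : Fin ℓ → Fin n, Function.Injective f ∧ x = cycleVec f}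

section
open Equiv

theorem cy_greedy {τ α : Type*} [DecidableEq α] (foot : τ → Finset α) (Pr : τ → Prop) (b B : ℕ)
    (h : ∀ F : Finset α, F.card ≤ B → ∃ t, Pr t ∧ Disjoint (foot t) F ∧ (foot t).card ≤ b)
    (r : ℕ) : ∀ F : Finset α, F.card + r * b ≤ B →
    ∃ t : Fin r → τ, (∀ i, Pr (t i) ∧ Disjoint (foot (t i)) F ∧ (foot (t i)).card ≤ b) ∧
      ∀ i j, i ≠ j → Disjoint (foot (t i)) (foot (t j)) := by
  induction r with
  | zero => intro F _; exact ⟨fun i => i.elim0, fun i => i.elim0, fun i => i.elim0⟩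
  | succ r ih =>
    intro F hF
    obtain ⟨t0, h1, h2, h3⟩ := h F (by lia)
    obtain ⟨t, ht, hd⟩ := ih (F ∪ foot t0) (by
      have := Finset.card_union_le F (foot t0)
      have e : (r + 1) * b = r * b + b := by ring
      lia)
    refine ⟨Fin.cons t0 t, ?_, ?_⟩
    · intro i
      refine Fin.cases ?_ ?_ i
      · exact ⟨h1, h2, h3⟩
      · intro i
        obtain ⟨a, b, c⟩ := ht i
        rw [Finset.disjoint_union_right] at b
        exact ⟨a, b.1, c⟩
    · intro i j
      refine Fin.cases ?_ (fun i => ?_) i <;> refine Fin.cases ?_ (fun j => ?_) j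
      · simp
      · intro _
        have := (ht j).2.1
        rw [Finset.disjoint_union_right] at this
        exact this.2.symm
      · intro _
        have := (ht i).2.1
        rw [Finset.disjoint_union_right] at this
        exact this.2
      · intro hij
        exact hd i j (by rintro rfl; exact hij rfl)

theorem cy_pig {α I : Type*} [Fintype α] [DecidableEq α] [Fintype I] (G : Subgroup (Perm α))
    (col : Perm α → I) (hcol : ∀ g g', col g = col g' → g⁻¹ * g' ∈ G) (w q : ℕ)
    (hq : Fintype.card I < q ^ w) (p : Fin w → α) (hp : Function.Injective p)
    (S : Fin w → Finset α) (hS : ∀ i, w * q ≤ (S i).card) (hpS : ∀ i j, p j ∉ S i) :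
    ∃ x ∈ G, ∃ M : Finset α, M.card ≤ 2 * w ∧ (∀ y ∈ M, ∃ i, y ∈ S i) ∧
      (∀ y, y ∉ M → (∀ j, y ≠ p j) → x y = y) ∧
      ∃ i, (∃ u ∈ S i, x (p i) = u) ∧ ∃ v ∈ S i, x v = p i := by
  classical
  obtain ⟨z, hz, hzS⟩ := (Finset.all_card_le_biUnion_card_iff_exists_injective
    (fun ia : Fin w × Fin q => S ia.1)).1 (by
      intro s
      rcases s.eq_empty_or_nonempty with rfl | ⟨a, ha⟩
      · simp
      · calc s.card ≤ Fintype.card (Fin w × Fin q) := Finset.card_le_univ s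
          _ = w * q := by simp
          _ ≤ (S a.1).card := hS _
          _ ≤ _ := Finset.card_le_card (Finset.subset_biUnion_of_mem
              (fun ia : Fin w × Fin q => S ia.1) ha))
  let φ' : Fin w × Option (Fin q) → α := fun x => x.2.elim (p x.1) (fun a => z (x.1, a))
  have hφ' : Function.Injective φ' := by
    rintro ⟨i, a⟩ ⟨j, b⟩ h
    cases a with
    | none =>
      cases b with
      | none => simp only [φ', Option.elim] at h; rw [hp h]
      | some b => simp only [φ', Option.elim] at h; exact absurd (hzS (j, b)) (h ▸ hpS _ _)
    | some a =>
      cases b with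
      | none => simp only [φ', Option.elim] at h; exact absurd (hzS (i, a)) (h ▸ hpS _ _)
      | some b =>
        simp only [φ', Option.elim] at h
        have := hz h
        simp at this
        rw [this.1, this.2]
  let φ : Fin w × Option (Fin q) ↪ α := ⟨φ', hφ'⟩
  let ψ : (Fin w → Fin q) → Perm α := fun c =>
    Perm.viaEmbedding (Equiv.prodCongrRight (fun i => swap none (some (c i)))) φ
  have hψ : ∀ c i o, ψ c (φ (i, o)) = φ (i, swap none (some (c i)) o) := by
    intro c i o
    simp only [ψ]
    rw [Perm.viaEmbedding_apply]
    rfl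
  have hψi : ∀ c i o, (ψ c)⁻¹ (φ (i, o)) = φ (i, swap none (some (c i)) o) := by
    intro c i o
    rw [Perm.inv_eq_iff_eq, hψ, swap_apply_self]
  have hψn : ∀ c y, y ∉ Set.range φ → ψ c y = y := by
    intro c y hy
    exact Perm.viaEmbedding_apply_of_notMem _ _ _ hy
  obtain ⟨c, c', hcc, hc⟩ := Fintype.exists_ne_map_eq_of_card_lt (fun c => col (ψ c))
    (by simpa using hq)
  refine ⟨(ψ c)⁻¹ * ψ c', hcol _ _ hc,
    Finset.univ.image (fun i => z (i, c i)) ∪ Finset.univ.image (fun i => z (i, c' i)),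
    ?_, ?_, ?_, ?_⟩
  · refine (Finset.card_union_le _ _).trans ?_
    have h1 := Finset.card_image_le (s := Finset.univ) (f := fun i : Fin w => z (i, c i))
    have h2 := Finset.card_image_le (s := Finset.univ) (f := fun i : Fin w => z (i, c' i))
    simp at h1 h2
    lia
  · intro y hy
    simp only [Finset.mem_union, Finset.mem_image, Finset.mem_univ, true_and] at hy
    rcases hy with ⟨i, rfl⟩ | ⟨i, rfl⟩
    · exact ⟨i, hzS _⟩
    · exact ⟨i, hzS _⟩
  · intro y hy hyp
    by_cases hr : y ∈ Set.range φ
    · obtain ⟨⟨i, o⟩, rfl⟩ := hr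
      cases o with
      | none => exact absurd rfl (hyp i)
      | some o =>
        simp only [Finset.mem_union, Finset.mem_image, Finset.mem_univ, true_and, not_or,
          not_exists] at hy
        have h1 : c i ≠ o := fun h => hy.1 i (by rw [h]; rfl)
        have h2 : c' i ≠ o := fun h => hy.2 i (by rw [h]; rfl)
        rw [Perm.mul_apply, hψ, swap_apply_of_ne_of_ne (by simp) (by simpa using h2.symm), hψi,
          swap_apply_of_ne_of_ne (by simp) (by simpa using h1.symm)]
    · rw [Perm.mul_apply, hψn _ _ hr, Perm.inv_eq_iff_eq, hψn _ _ hr]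
  · obtain ⟨i, hi⟩ := Function.ne_iff.1 hcc
    refine ⟨i, ⟨z (i, c' i), hzS (i, c' i), ?_⟩, ⟨z (i, c i), hzS (i, c i), ?_⟩⟩
    · change ((ψ c)⁻¹ * ψ c') (φ (i, none)) = φ (i, some (c' i))
      rw [Perm.mul_apply, hψ, swap_apply_left, hψi,
          swap_apply_of_ne_of_ne (by simp) (by simpa using Ne.symm hi)]
    · change ((ψ c)⁻¹ * ψ c') (φ (i, some (c i))) = φ (i, none)
      rw [Perm.mul_apply, hψ, swap_apply_of_ne_of_ne (by simp) (by simpa using hi), hψi,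
        swap_apply_right]

def cyTri {α : Type*} [DecidableEq α] (a b c : α) : Perm α := swap a b * swap b c

theorem cyTri_conj {α : Type*} [DecidableEq α] (g : Perm α) (a b c : α) :
    g * cyTri a b c * g⁻¹ = cyTri (g a) (g b) (g c) := by
  simp only [cyTri, swap_apply_apply]; group

theorem cyTri_conj_mem {α : Type*} [DecidableEq α] {G : Subgroup (Perm α)} {g : Perm α}
    (hg : g ∈ G) {a b c : α} (h : cyTri a b c ∈ G) : cyTri (g a) (g b) (g c) ∈ G := by
  rw [← cyTri_conj]; exact G.mul_mem (G.mul_mem hg h) (G.inv_mem hg)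

theorem cyTri_rot {α : Type*} [DecidableEq α] {a b c : α} (hab : a ≠ b) (hac : a ≠ c)
    (hbc : b ≠ c) : cyTri a b c = cyTri b c a := by
  ext x; simp only [cyTri, Perm.mul_apply, swap_apply_def]; grind

theorem cyTri_inv {α : Type*} [DecidableEq α] (a b c : α) : (cyTri a b c)⁻¹ = cyTri c b a := by
  simp only [cyTri, mul_inv_rev, swap_inv]; rw [swap_comm b c, swap_comm a b]

theorem cyTri_comm {α : Type*} [DecidableEq α] (x y : Perm α) (a : α) (hx : x a ≠ a)
    (hy : y a ≠ a) (h : ∀ d, d ≠ a → x d = d ∨ y d = d) :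
    x * y * x⁻¹ * y⁻¹ = cyTri a (x a) (y a) := by
  have key : x * y = cyTri a (x a) (y a) * (y * x) := by
    have hxi := x.injective
    have hyi := y.injective
    ext d
    simp only [Perm.mul_apply, cyTri, swap_apply_def]
    have e1 := h d
    have e2 := h (x d)
    have e3 := h (y d)
    have e4 := h (x a)
    have e5 := h (y a)
    have i1 := @hxi d a
    have i2 := @hyi d a
    have i3 := @hxi (y d) a
    have i4 := @hyi (x d) a
    have i5 := @hxi (x d) d
    have i6 := @hyi (y d) d
    have i7 := @hxi (x a) a
    have i8 := @hyi (y a) a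
    have i9 := @hxi (y a) (x a)
    have i10 := @hyi (y a) (x a)
    have i11 := @hyi (x d) d
    have i12 := @hxi (y d) d
    have i13 := @hyi (x d) (y d)
    have i14 := @hxi (x d) (y d)
    by_cases hd : d = a
    · split_ifs <;> grind
    · rcases e1 hd with e1 | e1 <;> by_cases hxd : x d = a <;> by_cases hyd : y d = a <;>
        split_ifs <;> grind
  rw [key]; group



def cyRel {α : Type*} [DecidableEq α] (G : Subgroup (Perm α)) (a b : α) : Prop :=
  a = b ∨ ∃ c, a ≠ b ∧ a ≠ c ∧ b ≠ c ∧ cyTri a b c ∈ G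

theorem cyTri_apply1 {α : Type*} [DecidableEq α] {a b c : α} (hab : a ≠ b) (hac : a ≠ c) :
    cyTri a b c a = b := by
  simp [cyTri, Perm.mul_apply, swap_apply_of_ne_of_ne hab hac]

theorem cyTri_apply_ne {α : Type*} [DecidableEq α] {a b c d : α} (h1 : d ≠ a) (h2 : d ≠ b)
    (h3 : d ≠ c) : cyTri a b c d = d := by
  simp [cyTri, Perm.mul_apply, swap_apply_of_ne_of_ne, *]

theorem cyTri_rot_mem {α : Type*} [DecidableEq α] {G : Subgroup (Perm α)} {a b c : α}
    (hab : a ≠ b) (hac : a ≠ c) (hbc : b ≠ c) (h : cyTri a b c ∈ G) : cyTri b c a ∈ G := by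
  rwa [← cyTri_rot hab hac hbc]

theorem cyTri_flip_mem {α : Type*} [DecidableEq α] {G : Subgroup (Perm α)} {a b c : α}
    (h : cyTri a b c ∈ G) : cyTri c b a ∈ G := by
  rw [← cyTri_inv]; exact G.inv_mem h

theorem cyTri_all {α : Type*} [DecidableEq α] {G : Subgroup (Perm α)} {a b c : α}
    (hab : a ≠ b) (hac : a ≠ c) (hbc : b ≠ c) (h : cyTri a b c ∈ G) :
    cyTri a c b ∈ G ∧ cyTri b a c ∈ G ∧ cyTri b c a ∈ G ∧ cyTri c a b ∈ G ∧ cyTri c b a ∈ G := by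
  have h1 := cyTri_rot_mem hab hac hbc h
  have h2 := cyTri_rot_mem hbc hab.symm hac.symm h1
  exact ⟨cyTri_flip_mem h1, cyTri_flip_mem h2, h1, h2, cyTri_flip_mem h⟩

theorem cyRel_symm {α : Type*} [DecidableEq α] {G : Subgroup (Perm α)} {a b : α}
    (h : cyRel G a b) : cyRel G b a := by
  rcases h with rfl | ⟨c, h1, h2, h3, h⟩
  · exact Or.inl rfl
  · exact Or.inr ⟨c, h1.symm, h3, h2, cyTri_rot_mem h3.symm h2.symm h1.symm (cyTri_flip_mem h)⟩

theorem cyRel_trans {α : Type*} [DecidableEq α] {G : Subgroup (Perm α)} {a b d : α}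
    (h : cyRel G a b) (h' : cyRel G b d) : cyRel G a d := by
  by_cases had : a = d
  · exact Or.inl had
  rcases h with rfl | ⟨c, h1, h2, h3, h⟩
  · exact h'
  rcases h' with rfl | ⟨e, k1, k2, k3, k⟩
  · exact Or.inr ⟨c, h1, h2, h3, h⟩
  by_cases hdc : d = c
  · subst hdc
    exact Or.inr ⟨b, h2, h1, h3.symm, (cyTri_all h1 h2 h3 h).1⟩
  · have hf : cyTri b a c ∈ G := cyTri_rot_mem h3.symm h2.symm h1.symm (cyTri_flip_mem h)
    have := cyTri_conj_mem hf k
    rw [cyTri_apply1 h1.symm h3, cyTri_apply_ne k1.symm (Ne.symm had) hdc] at this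
    refine Or.inr ⟨_, had, ?_, ?_, this⟩
    · intro hh
      have : cyTri b a c b = cyTri b a c e := by rw [cyTri_apply1 h1.symm h3]; exact hh
      exact k2 ((cyTri b a c).injective this)
    · intro hh
      have : cyTri b a c d = cyTri b a c e := by
        rw [cyTri_apply_ne k1.symm (Ne.symm had) hdc]; exact hh
      exact k3 ((cyTri b a c).injective this)

theorem cyTri_four {α : Type*} [DecidableEq α] {G : Subgroup (Perm α)} {a b c d : α}
    (hab : a ≠ b) (hac : a ≠ c) (had : a ≠ d) (hbc : b ≠ c) (hbd : b ≠ d) (hcd : c ≠ d)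
    (h : cyTri a b d ∈ G) (h' : cyTri a c d ∈ G) : cyTri a b c ∈ G := by
  have h1 : cyTri d c a ∈ G := cyTri_flip_mem h'
  -- d → c → a → d
  have e1 : cyTri d c a d = c := cyTri_apply1 (by grind) (by grind)
  have e2 : cyTri d c a a = d := by
    rw [cyTri_rot (by grind) (by grind) (by grind), cyTri_rot (by grind) (by grind) (by grind)]
    exact cyTri_apply1 (by grind) (by grind)
  have e3 : cyTri d c a b = b := cyTri_apply_ne (by grind) (by grind) (by grind)
  have h2 := cyTri_conj_mem h1 h
  rw [e1, e2, e3] at h2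
  -- h2 : d b c ; conjugate by d → b → a → d
  have h3 : cyTri d b a ∈ G := cyTri_flip_mem h
  have f1 : cyTri d b a d = b := cyTri_apply1 (by grind) (by grind)
  have f2 : cyTri d b a b = a := by
    rw [cyTri_rot (by grind) (by grind) (by grind)]
    exact cyTri_apply1 (by grind) (by grind)
  have f3 : cyTri d b a c = c := cyTri_apply_ne (by grind) (by grind) (by grind)
  have h4 := cyTri_conj_mem h3 h2
  rw [f1, f2, f3] at h4
  exact cyTri_rot_mem hac.symm hbc.symm hab (cyTri_flip_mem h4)

theorem cyTri_of_rel {α : Type*} [DecidableEq α] {G : Subgroup (Perm α)} {a b c : α}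
    (hab : a ≠ b) (hac : a ≠ c) (hbc : b ≠ c) (h : cyRel G a b) (h' : cyRel G a c) :
    cyTri a b c ∈ G := by
  rcases h with h | ⟨d, h1, h2, h3, h⟩
  · exact absurd h hab
  by_cases hdc : d = c
  · rwa [hdc] at h
  have hda : cyRel G d a := cyRel_symm (Or.inr ⟨b, h2, h1, h3.symm,
    (cyTri_all h1 h2 h3 h).1⟩)
  rcases cyRel_trans hda h' with h4 | ⟨e, k1, k2, k3, k⟩
  · exact absurd h4 hdc
  by_cases hea : e = a
  · subst hea
    exact cyTri_four hab hac h2 hbc h3 k1.symm h (cyTri_all k1 k2 k3 k).2.2.2.2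
  by_cases heb : e = b
  · subst heb
    exact (cyTri_all hab.symm hbc hac (cyTri_four hab.symm hbc h3 hac h2 k1.symm
      (cyTri_all h1 h2 h3 h).2.1 (cyTri_all k1 k2 k3 k).2.2.2.2)).2.1
  · have := cyTri_conj_mem k h
    rwa [cyTri_apply_ne h2 hac (Ne.symm hea), cyTri_apply_ne h3 hbc (Ne.symm heb),
      cyTri_apply1 k1 k2] at this


theorem cy_card_sdiff {α : Type*} [Fintype α] [DecidableEq α] (F : Finset α) :
    Fintype.card α ≤ (Finset.univ \ F).card + F.card := by
  rw [Finset.card_sdiff_add_card]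
  exact Finset.card_le_card (Finset.subset_union_left)

theorem cy_stepA {α I : Type*} [Fintype α] [DecidableEq α] [Fintype I] (G : Subgroup (Perm α))
    (col : Perm α → I) (hcol : ∀ g g', col g = col g' → g⁻¹ * g' ∈ G) (w q : ℕ)
    (hq : Fintype.card I < q ^ w) (hn : 4 * (w * q) ≤ Fintype.card α)
    (hn2 : 100 * (w * w) ≤ Fintype.card α) (F : Finset α) (hF : F.card ≤ Fintype.card α / 2) :
    ∃ t : Perm α × α × Finset α, (t.1 ∈ G ∧ t.1 t.2.1 ≠ t.2.1 ∧ t.2.1 ∈ t.2.2 ∧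
      ∀ y, y ∉ t.2.2 → t.1 y = y) ∧ Disjoint t.2.2 F ∧ t.2.2.card ≤ 3 * w := by
  have hww : w ≤ w * w := Nat.le_mul_self w
  have h1 := cy_card_sdiff F
  obtain ⟨P, hP, hPc⟩ := Finset.exists_subset_card_eq (s := Finset.univ \ F) (n := w) (by lia)
  let p : Fin w → α := fun i => (P.equivFinOfCardEq hPc).symm i
  have hp : Function.Injective p := fun i j h => by
    simpa [p] using h
  have hpP : ∀ i, p i ∈ P := fun i => ((P.equivFinOfCardEq hPc).symm i).2
  have h2 := cy_card_sdiff (F ∪ P)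
  have h3 := Finset.card_union_le F P
  obtain ⟨x, hx, M, hM, hMS, hfix, i, ⟨u, hu, hxu⟩, -⟩ := cy_pig G col hcol w q hq p hp
    (fun _ => Finset.univ \ (F ∪ P)) (fun _ => by lia) (by simp [hpP])
  refine ⟨(x, p i, M ∪ P), ⟨hx, ?_, ?_, ?_⟩, ?_, ?_⟩
  · rw [hxu]; rintro rfl; simp [hpP] at hu
  · simp [hpP]
  · intro y hy
    simp only [Finset.mem_union, not_or] at hy
    refine hfix y hy.1 ?_
    rintro j rfl
    exact hy.2 (hpP j)
  · rw [Finset.disjoint_left]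
    intro y hy hyF
    simp only [Finset.mem_union] at hy
    rcases hy with hy | hy
    · obtain ⟨i, hi⟩ := hMS y hy
      simp [hyF] at hi
    · simpa [hyF] using hP hy
  · have := Finset.card_union_le M P
    simp only
    lia

theorem cy_stepB {α I : Type*} [Fintype α] [DecidableEq α] [Fintype I] (G : Subgroup (Perm α))
    (col : Perm α → I) (hcol : ∀ g g', col g = col g' → g⁻¹ * g' ∈ G) (w q : ℕ)
    (hq : Fintype.card I < q ^ w) (hn : 4 * (w * q) ≤ Fintype.card α)
    (hn2 : 100 * (w * w) ≤ Fintype.card α) (F : Finset α) (hF : F.card ≤ Fintype.card α / 4) :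
    ∃ t : α × α × α, (cyTri t.1 t.2.1 t.2.2 ∈ G ∧ t.1 ≠ t.2.1 ∧ t.1 ≠ t.2.2 ∧ t.2.1 ≠ t.2.2) ∧
      Disjoint ({t.1, t.2.1, t.2.2} : Finset α) F ∧
      ({t.1, t.2.1, t.2.2} : Finset α).card ≤ 3 := by
  have hww : w ≤ w * w := Nat.le_mul_self w
  obtain ⟨t, ht, hd⟩ := cy_greedy (fun t : Perm α × α × Finset α => t.2.2)
    (fun t => t.1 ∈ G ∧ t.1 t.2.1 ≠ t.2.1 ∧ t.2.1 ∈ t.2.2 ∧ ∀ y, y ∉ t.2.2 → t.1 y = y)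
    (3 * w) (Fintype.card α / 2) (fun F hF => cy_stepA G col hcol w q hq hn hn2 F hF) w F
    (by have : w * (3 * w) = 3 * (w * w) := by ring
        lia)
  have hp : Function.Injective (fun i => (t i).2.1) := by
    intro i j hij
    by_contra hne
    have h1 := (ht i).1.2.2.1
    have h2 := (ht j).1.2.2.1
    simp only at hij
    rw [← hij] at h2
    exact Finset.disjoint_left.1 (hd i j hne) h1 h2
  let A : Finset α := Finset.univ.biUnion (fun i => (t i).2.2)
  have hA : A.card ≤ 3 * (w * w) := by
    have := Finset.card_biUnion_le (s := Finset.univ) (t := fun i => (t i).2.2)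
    refine this.trans ((Finset.sum_le_sum (fun i _ => (ht i).2.2)).trans ?_)
    simp; apply le_of_eq; ring
  have hmA : ∀ i y, y ∈ (t i).2.2 → y ∈ A := fun i y hy =>
    Finset.mem_biUnion.2 ⟨i, Finset.mem_univ _, hy⟩
  have h2 := cy_card_sdiff (F ∪ A)
  have h3 := Finset.card_union_le F A
  obtain ⟨y, hy, M, hM, hMS, hfix, i, ⟨u, hu, hxu⟩, -⟩ := cy_pig G col hcol w q hq
    (fun i => (t i).2.1) hp
    (fun _ => Finset.univ \ (F ∪ A)) (fun _ => by lia)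
    (fun _ j => by simp [hmA j _ (ht j).1.2.2.1])
  obtain ⟨⟨hx, hxa, haM, hxfix⟩, hdF, -⟩ := ht i
  simp only [Finset.mem_sdiff, Finset.mem_univ, true_and, Finset.mem_union, not_or] at hu
  set x := (t i).1 with hxdef
  set a := (t i).2.1 with hadef
  have hxaM : x a ∈ (t i).2.2 := by
    by_contra hh
    exact hxa (x.injective (hxfix _ hh))
  have haA := hmA i a haM
  have hxaA := hmA i _ hxaM
  have hya : y a ≠ a := by
    rw [show y a = u from hxu]; rintro rfl; exact hu.2 haA
  have hc := cyTri_comm x y a hxa hya (by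
    intro d hda
    by_cases hdM : d ∈ (t i).2.2
    · right
      refine hfix d ?_ ?_
      · intro hdM'
        obtain ⟨j, hj⟩ := hMS d hdM'
        simp [hmA i d hdM] at hj
      · rintro j rfl
        by_cases hij : i = j
        · subst hij; exact hda rfl
        · exact Finset.disjoint_left.1 (hd i j hij) hdM (ht j).1.2.2.1
    · left; exact hxfix d hdM)
  have hyu : y a = u := hxu
  refine ⟨(a, x a, y a), ⟨?_, hxa.symm, hya.symm, ?_⟩, ?_, Finset.card_le_three⟩
  · simp only
    rw [← hc]
    exact G.mul_mem (G.mul_mem (G.mul_mem hx hy) (G.inv_mem hx)) (G.inv_mem hy)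
  · simp only
    rw [hyu]; intro h; exact hu.2 (h ▸ hxaA)
  · rw [Finset.disjoint_left] at hdF ⊢
    intro z hz
    simp only [Finset.mem_insert, Finset.mem_singleton] at hz
    rcases hz with rfl | rfl | rfl
    · exact hdF haM
    · exact hdF hxaM
    · rw [hyu]; exact hu.1

open Classical in
theorem cy_stepD {α I : Type*} [Fintype α] [DecidableEq α] [Fintype I] (G : Subgroup (Perm α))
    (col : Perm α → I) (hcol : ∀ g g', col g = col g' → g⁻¹ * g' ∈ G) (w q : ℕ)
    (hq : Fintype.card I < q ^ w) (hn : 4 * (w * q) ≤ Fintype.card α)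
    (hn2 : 100 * (w * w) ≤ Fintype.card α) :
    ∃ p : α, Fintype.card α ≤ 2 * (Finset.univ.filter (fun y => cyRel G p y)).card := by
  have hww : w ≤ w * w := Nat.le_mul_self w
  obtain ⟨t, ht, hd⟩ := cy_greedy (fun t : α × α × α => ({t.1, t.2.1, t.2.2} : Finset α))
    (fun t => cyTri t.1 t.2.1 t.2.2 ∈ G ∧ t.1 ≠ t.2.1 ∧ t.1 ≠ t.2.2 ∧ t.2.1 ≠ t.2.2)
    3 (Fintype.card α / 4) (fun F hF => cy_stepB G col hcol w q hq hn hn2 F hF) w ∅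
    (by simp; lia)
  by_contra! hcon
  let A : Finset α := Finset.univ.biUnion (fun i => ({(t i).1, (t i).2.1, (t i).2.2} : Finset α))
  have hA : A.card ≤ 3 * w := by
    have := Finset.card_biUnion_le (s := Finset.univ)
      (t := fun i => ({(t i).1, (t i).2.1, (t i).2.2} : Finset α))
    refine this.trans ((Finset.sum_le_sum (fun i _ => (ht i).2.2)).trans ?_)
    simp; apply le_of_eq; ring
  have hmA : ∀ i y, y ∈ ({(t i).1, (t i).2.1, (t i).2.2} : Finset α) → y ∈ A := fun i y hy =>
    Finset.mem_biUnion.2 ⟨i, Finset.mem_univ _, hy⟩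
  have hp : Function.Injective (fun i => (t i).1) := by
    intro i j hij
    by_contra hne
    simp only at hij
    have h0 : (t i).1 ∈ ({(t i).1, (t i).2.1, (t i).2.2} : Finset α) := by simp
    exact Finset.disjoint_left.1 (hd i j hne) h0 (by simp [hij])
  obtain ⟨y, hy, M, hM, hMS, hfix, i, ⟨u, hu, hxu⟩, -⟩ := cy_pig G col hcol w q hq
    (fun i => (t i).1) hp
    (fun i => Finset.univ \ (Finset.univ.filter (fun y => cyRel G (t i).1 y) ∪ A)) (fun i => by
      have h2 := cy_card_sdiff (Finset.univ.filter (fun y => cyRel G (t i).1 y) ∪ A)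
      have h3 := Finset.card_union_le (Finset.univ.filter (fun y => cyRel G (t i).1 y)) A
      have h4 := hcon (t i).1
      lia)
    (fun i j => by simp [hmA j (t j).1 (by simp)])
  obtain ⟨⟨hG, h12, h13, h23⟩, -, -⟩ := ht i
  have hfixA : ∀ z ∈ ({(t i).1, (t i).2.1, (t i).2.2} : Finset α), z ≠ (t i).1 → y z = z := by
    intro z hz hz1
    refine hfix z ?_ ?_
    · intro hzM
      obtain ⟨j, hj⟩ := hMS z hzM
      simp [hmA i z hz] at hj
    · rintro j rfl
      by_cases hij : i = j
      · subst hij; exact hz1 rfl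
      · exact Finset.disjoint_left.1 (hd i j hij) hz (by simp)
  have hc := cyTri_conj_mem hy hG
  rw [hfixA (t i).2.1 (by simp) h12.symm, hfixA (t i).2.2 (by simp) h13.symm] at hc
  rw [show y (t i).1 = u from hxu] at hc
  simp only [Finset.mem_sdiff, Finset.mem_univ, true_and, Finset.mem_union, not_or,
    Finset.mem_filter] at hu
  have hu1 : u ≠ (t i).2.1 := fun h => hu.2 (h ▸ hmA i _ (by simp))
  have hu2 : u ≠ (t i).2.2 := fun h => hu.2 (h ▸ hmA i _ (by simp))
  exact hu.1 (cyRel_trans (Or.inr ⟨_, h12, h13, h23, hG⟩)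
    (cyRel_symm (Or.inr ⟨_, hu1, hu2, h23, hc⟩)))

open Classical in
theorem cy_stepE {α I : Type*} [Fintype α] [DecidableEq α] [Fintype I] (G : Subgroup (Perm α))
    (col : Perm α → I) (hcol : ∀ g g', col g = col g' → g⁻¹ * g' ∈ G) (w q : ℕ)
    (hq : Fintype.card I < q ^ w) (hw : 1 ≤ w) (hn : 4 * (w * q) ≤ Fintype.card α)
    (hn2 : 100 * (w * w) ≤ Fintype.card α) :
    ∃ V : Finset α, V.card < w ∧ ∀ a b c, a ∉ V → b ∉ V → c ∉ V → a ≠ b → a ≠ c → b ≠ c →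
      cyTri a b c ∈ G := by
  have hww : w ≤ w * w := Nat.le_mul_self w
  obtain ⟨p0, hp0⟩ := cy_stepD G col hcol w q hq hn hn2
  set X := Finset.univ.filter (fun y => cyRel G p0 y) with hX
  have hXG : ∀ a b c, a ∈ X → b ∈ X → c ∈ X → a ≠ b → a ≠ c → b ≠ c → cyTri a b c ∈ G := by
    intro a b c ha hb hc hab hac hbc
    simp only [hX, Finset.mem_filter, Finset.mem_univ, true_and] at ha hb hc
    exact cyTri_of_rel hab hac hbc (cyRel_trans (cyRel_symm ha) hb)
      (cyRel_trans (cyRel_symm ha) hc)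
  refine ⟨Finset.univ \ X, ?_, ?_⟩
  · by_contra! hcon
    obtain ⟨P, hP, hPc⟩ := Finset.exists_subset_card_eq hcon
    let p : Fin w → α := fun i => (P.equivFinOfCardEq hPc).symm i
    have hp : Function.Injective p := fun i j h => by
      simpa [p] using h
    have hpX : ∀ i, p i ∉ X := fun i => by
      have := hP ((P.equivFinOfCardEq hPc).symm i).2
      simpa using this
    obtain ⟨a, ha, b, hb, hab⟩ := Finset.one_lt_card.1 (show 1 < X.card by lia)
    obtain ⟨y, hy, M, hM, hMS, hfix, i, -, ⟨v, hv, hxv⟩⟩ := cy_pig G col hcol w q hq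
      p hp (fun i => X \ {a, b}) (fun i => by
        have h1 := Finset.le_card_sdiff {a, b} X
        have h2 := Finset.card_le_two (a := a) (b := b)
        lia) (fun i j => by simp [hpX])
    simp only [Finset.mem_sdiff, Finset.mem_insert, Finset.mem_singleton, not_or] at hv
    have hfa : ∀ z, z ∈ X → (z = a ∨ z = b) → y z = z := by
      intro z hzX hz
      refine hfix z ?_ ?_
      · intro hzM
        obtain ⟨j, hj⟩ := hMS z hzM
        simp [hz] at hj
      · rintro j rfl; exact hpX j hzX
    have hc := cyTri_conj_mem hy (hXG v a b hv.1 ha hb hv.2.1 hv.2.2 hab)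
    rw [hxv, hfa a ha (Or.inl rfl), hfa b hb (Or.inr rfl)] at hc
    apply hpX i
    have h1 : p i ≠ a := fun h => hpX i (h ▸ ha)
    have h2 : p i ≠ b := fun h => hpX i (h ▸ hb)
    have := cyRel_symm (Or.inr ⟨_, h1, h2, hab, hc⟩)
    simp only [hX, Finset.mem_filter, Finset.mem_univ, true_and] at ha ⊢
    exact cyRel_trans ha this
  · intro a b c ha hb hc
    exact hXG a b c (by simpa using ha) (by simpa using hb) (by simpa using hc)

theorem cy_group (k : ℕ) : ∃ n0 : ℕ, ∀ n : ℕ, n0 ≤ n → ∀ (I : Type) [Fintype I]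
    (G : Subgroup (Perm (Fin n))) (col : Perm (Fin n) → I),
    (∀ g g', col g = col g' → g⁻¹ * g' ∈ G) → Fintype.card I ≤ n ^ k →
    ∃ V : Finset (Fin n), V.card ≤ k ∧ ∀ a b c, a ∉ V → b ∉ V → c ∉ V → a ≠ b → a ≠ c → b ≠ c →
      cyTri a b c ∈ G := by
  refine ⟨100 * ((k + 1) * (k + 1)) + (8 * (k + 1)) ^ (k + 1) + 1, ?_⟩
  intro n hn I _ G col hcol hI
  have hq : Fintype.card I < (n / (4 * (k + 1))) ^ (k + 1) := by
    refine lt_of_le_of_lt hI ?_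
    set q := n / (4 * (k + 1)) with hqd
    have h1 : n < 4 * (k + 1) * (q + 1) := by
      rw [hqd]; exact Nat.lt_mul_div_succ n (by lia)
    have hk : k + 1 ≤ (k + 1) * (k + 1) := Nat.le_mul_self _
    have hq1 : 1 ≤ q := by
      rw [hqd, Nat.one_le_div_iff (by lia)]; lia
    have h2 : n < 8 * (k + 1) * q := by nlinarith
    have hn0 : 0 < n := by lia
    by_contra! hcon
    have h3 : n ^ (k + 1) < (8 * (k + 1) * q) ^ (k + 1) := Nat.pow_lt_pow_left h2 (by lia)
    rw [mul_pow] at h3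
    have h4 : (8 * (k + 1)) ^ (k + 1) * q ^ (k + 1) ≤ n * n ^ k :=
      Nat.mul_le_mul (by lia) hcon
    rw [pow_succ, mul_comm] at h3
    lia
  obtain ⟨V, hV, h⟩ := cy_stepE G col hcol (k + 1) _ hq (by lia) (by
    rw [Fintype.card_fin]
    calc 4 * ((k + 1) * (n / (4 * (k + 1)))) = (4 * (k + 1)) * (n / (4 * (k + 1))) := by ring
      _ ≤ n := Nat.mul_div_le _ _) (by rw [Fintype.card_fin]; lia)
  exact ⟨V, by lia, h⟩


theorem cy_aff {E : Type*} [AddCommGroup E] [Module ℝ E] (φ : E →ᵃ[ℝ] ℝ) (w y : E) (t : ℝ) :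
    φ (w + t • (y - w)) = φ w + t * (φ y - φ w) := by
  have h := φ.apply_lineMap w y t
  rw [AffineMap.lineMap_apply, AffineMap.lineMap_apply] at h
  simp only [vsub_eq_sub, vadd_eq_add, smul_eq_mul] at h
  rw [add_comm w, h]; ring

theorem cy_affsum {E F ι : Type*} [AddCommGroup E] [Module ℝ E] [AddCommGroup F] [Module ℝ F]
    (φ : E →ᵃ[ℝ] F) (s : Finset ι)
    (w : ι → ℝ) (hw : ∑ i ∈ s, w i = 1) (y : ι → E) :
    φ (∑ i ∈ s, w i • y i) = ∑ i ∈ s, w i • φ (y i) := by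
  have hd : ∀ y, φ y = φ.linear y + φ 0 := fun y => by
    have := φ.linearMap_vsub y 0
    simp only [vsub_eq_sub, sub_zero] at this
    rw [this]; abel
  rw [hd, map_sum]
  simp_rw [map_smul]
  conv_rhs => enter [2, i]; rw [hd (y i), smul_add]
  rw [Finset.sum_add_distrib, ← Finset.sum_smul, hw, one_smul]

/-- `Q` is described by equations `Φ` and `f` inequalities. -/
def cyDesc {E : Type*} [AddCommGroup E] [Module ℝ E] (Q : Set E) (f : ℕ) : Prop :=
  ∃ (Φ : Set (E →ᵃ[ℝ] ℝ)) (σ : Fin f → E →ᵃ[ℝ] ℝ),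
    Q = {y | (∀ φ ∈ Φ, φ y = 0) ∧ ∀ i, 0 ≤ σ i y}

theorem cy_min1 {E : Type*} [AddCommGroup E] [Module ℝ E] (Q : Set E) (f : ℕ)
    (hmin : ¬ cyDesc Q f) (Φ : Set (E →ᵃ[ℝ] ℝ)) (σ : Fin (f + 1) → E →ᵃ[ℝ] ℝ)
    (hQ : Q = {y | (∀ φ ∈ Φ, φ y = 0) ∧ ∀ i, 0 ≤ σ i y}) (i : Fin (f + 1)) :
    (∃ y ∈ Q, 0 < σ i y) ∧
      ∃ z, (∀ φ ∈ Φ, φ z = 0) ∧ σ i z < 0 ∧ ∀ j, j ≠ i → 0 ≤ σ j z := by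
  constructor
  · by_contra! hcon
    apply hmin
    refine ⟨insert (σ i) Φ, fun j => σ (i.succAbove j), ?_⟩
    ext y
    constructor
    · intro hy
      have hy' := hy
      rw [hQ] at hy'
      refine ⟨?_, fun j => hy'.2 _⟩
      intro φ hφ
      rcases hφ with rfl | hφ
      · exact le_antisymm (hcon y hy) (hy'.2 i)
      · exact hy'.1 φ hφ
    · rintro ⟨h1, h2⟩
      rw [hQ]
      refine ⟨fun φ hφ => h1 φ (Or.inr hφ), ?_⟩
      rw [Fin.forall_iff_succAbove i]
      exact ⟨(h1 _ (Or.inl rfl)).ge, h2⟩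
  · by_contra! hcon
    apply hmin
    refine ⟨Φ, fun j => σ (i.succAbove j), ?_⟩
    ext y
    constructor
    · intro hy
      rw [hQ] at hy
      exact ⟨hy.1, fun j => hy.2 _⟩
    · rintro ⟨h1, h2⟩
      rw [hQ]
      refine ⟨h1, ?_⟩
      rw [Fin.forall_iff_succAbove i]
      refine ⟨?_, h2⟩
      by_contra! hneg
      obtain ⟨j, hj, hj2⟩ := hcon y h1 hneg
      obtain ⟨j', rfl⟩ := Fin.exists_succAbove_eq hj
      exact absurd (h2 j') (not_le.2 hj2)

theorem cy_eps {I : Type*} [Finite I] (a b : I → ℝ) : 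
    ∃ ε : ℝ, 0 < ε ∧ ε < 1 ∧ ∀ j, 0 < a j → 0 < a j + ε * b j := by
  have h : ∀ᶠ ε : ℝ in nhdsWithin 0 (Set.Ioi 0), 0 < ε ∧ ε < 1 ∧ ∀ j, 0 < a j → 0 < a j + ε * b j := by
    refine Filter.Eventually.and self_mem_nhdsWithin (Filter.Eventually.and ?_ ?_)
    · exact nhdsWithin_le_nhds (gt_mem_nhds one_pos)
    · rw [Filter.eventually_all]
      intro j
      by_cases hj : 0 < a j
      · have hc : Filter.Tendsto (fun ε : ℝ => a j + ε * b j) (nhds 0) (nhds (a j + 0 * b j)) :=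
          Continuous.tendsto (by fun_prop) 0
        have : ∀ᶠ ε : ℝ in nhds 0, 0 < a j + ε * b j :=
          hc.eventually (lt_mem_nhds (by simpa using hj))
        filter_upwards [nhdsWithin_le_nhds this] with ε h _ using h
      · exact Filter.Eventually.of_forall fun ε h => absurd h hj
  exact h.exists

theorem cy_min2 {E : Type*} [AddCommGroup E] [Module ℝ E] (Q : Set E) (hne : Q.Nonempty) (f : ℕ)
    (Φ : Set (E →ᵃ[ℝ] ℝ)) (σ : Fin f → E →ᵃ[ℝ] ℝ)
    (hmin : ∀ f' < f, ¬ cyDesc Q f') 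
    (hQ : Q = {y | (∀ φ ∈ Φ, φ y = 0) ∧ ∀ i, 0 ≤ σ i y}) :
    ∃ y0, (∀ φ ∈ Φ, φ y0 = 0) ∧ (∀ i, 0 < σ i y0) ∧
      ∀ i, ∃ z, (∀ φ ∈ Φ, φ z = 0) ∧ σ i z = 0 ∧ ∀ j, j ≠ i → 0 < σ j z := by
  have key : ∀ i, (∃ y ∈ Q, 0 < σ i y) ∧
      ∃ z, (∀ φ ∈ Φ, φ z = 0) ∧ σ i z < 0 ∧ ∀ j, j ≠ i → 0 ≤ σ j z := by
    cases f with
    | zero => intro i; exact i.elim0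
    | succ f => exact cy_min1 Q f (hmin f (Nat.lt_succ_self f)) Φ σ hQ
  have h1 : ∀ S : Finset (Fin f), ∃ y ∈ Q, ∀ i ∈ S, 0 < σ i y := by
    intro S
    induction S using Finset.induction_on with
    | empty => obtain ⟨y, hy⟩ := hne; exact ⟨y, hy, by simp⟩
    | insert i S _ ih =>
      obtain ⟨y, hy, hS⟩ := ih
      obtain ⟨y', hy', hi⟩ := (key i).1
      rw [hQ] at hy hy'
      refine ⟨y + (1/2 : ℝ) • (y' - y), ?_, ?_⟩
      · rw [hQ]
        refine ⟨fun φ hφ => ?_, fun j => ?_⟩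
        · rw [cy_aff, hy.1 φ hφ, hy'.1 φ hφ]; simp
        · rw [cy_aff]; linarith [hy.2 j, hy'.2 j]
      · intro j hj
        rw [cy_aff]
        rcases Finset.mem_insert.1 hj with rfl | hj
        · linarith [hy.2 j]
        · linarith [hS j hj, hy'.2 j]
  obtain ⟨y0, hy0, hpos⟩ := h1 Finset.univ
  rw [hQ] at hy0
  refine ⟨y0, hy0.1, fun i => hpos i (Finset.mem_univ i), fun i => ?_⟩
  obtain ⟨z, hzL, hzi, hzj⟩ := (key i).2
  have hyi := hpos i (Finset.mem_univ i)
  have hd : 0 < σ i y0 - σ i z := by linarith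
  refine ⟨y0 + (σ i y0 / (σ i y0 - σ i z)) • (z - y0), ?_, ?_, ?_⟩
  · intro φ hφ
    rw [cy_aff, hy0.1 φ hφ, hzL φ hφ]; simp
  · rw [cy_aff]; field_simp; ring
  · intro j hj
    rw [cy_aff]
    have h1 : σ i y0 / (σ i y0 - σ i z) < 1 := by rw [div_lt_one hd]; linarith
    have h0 : 0 < σ i y0 / (σ i y0 - σ i z) := by positivity
    set t := σ i y0 / (σ i y0 - σ i z)
    nlinarith [hzj j hj, hpos j (Finset.mem_univ j), mul_pos (sub_pos.2 h1) (hpos j (Finset.mem_univ j)), mul_nonneg h0.le (hzj j hj)]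

section
variable {E : Type*} [AddCommGroup E] [Module ℝ E] {I : Type*} [Finite I] {Q : Set E}
    {Φ : Set (E →ᵃ[ℝ] ℝ)} {σ : I → E →ᵃ[ℝ] ℝ} 

theorem cy_L (hQ : Q = {y | (∀ φ ∈ Φ, φ y = 0) ∧ ∀ i, 0 ≤ σ i y})
    {y0 : E} (h0 : ∀ φ ∈ Φ, φ y0 = 0) (hpos : ∀ i, 0 < σ i y0)
    (κ : E →ᵃ[ℝ] E) (hκ : ∀ y ∈ Q, κ y ∈ Q) (y : E) (hy : ∀ φ ∈ Φ, φ y = 0) :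
    ∀ φ ∈ Φ, φ (κ y) = 0 := by
  intro φ hφ
  obtain ⟨ε, hε, -, h⟩ := cy_eps (fun j => σ j y0) (fun j => σ j y - σ j y0)
  have hq0 : y0 ∈ Q := by rw [hQ]; exact ⟨h0, fun i => (hpos i).le⟩
  have hq : y0 + ε • (y - y0) ∈ Q := by
    rw [hQ]
    refine ⟨fun φ hφ => ?_, fun j => ?_⟩
    · rw [cy_aff, h0 φ hφ, hy φ hφ]; simp
    · rw [cy_aff]; exact (h j (hpos j)).le
  have e1 := hκ _ hq
  have e0 := hκ _ hq0
  rw [hQ] at e1 e0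
  have e1 := e1.1 φ hφ
  have e0 := e0.1 φ hφ
  have := cy_aff (φ.comp κ) y0 y ε
  simp only [AffineMap.comp_apply] at this
  rw [e1, e0] at this
  have h3 : ε * φ (κ y) = 0 := by linarith
  exact (mul_eq_zero.1 h3).resolve_left hε.ne'

theorem cy_facet (hQ : Q = {y | (∀ φ ∈ Φ, φ y = 0) ∧ ∀ i, 0 ≤ σ i y})
    {y0 : E} (h0 : ∀ φ ∈ Φ, φ y0 = 0) (hpos : ∀ i, 0 < σ i y0)
    (hz : ∀ i, ∃ z, (∀ φ ∈ Φ, φ z = 0) ∧ σ i z = 0 ∧ ∀ j, j ≠ i → 0 < σ j z)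
    (κ : E ≃ᵃ[ℝ] E) (hκ : ∀ y, κ y ∈ Q ↔ y ∈ Q) (i : I) :
    ∃ j, ∃ μ : ℝ, 0 < μ ∧ ∀ y, (∀ φ ∈ Φ, φ y = 0) → σ i (κ y) = μ * σ j y := by
  obtain ⟨z, hzL, hzi, hzj⟩ := hz i
  have hκ' : ∀ y ∈ Q, κ.symm y ∈ Q := fun y hy => by rw [← hκ]; simpa using hy
  have hLs := cy_L hQ h0 hpos (κ.symm : E →ᵃ[ℝ] E) hκ'
  have hL := cy_L hQ h0 hpos (κ : E →ᵃ[ℝ] E) (fun y hy => (hκ y).2 hy)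
  simp only [AffineEquiv.coe_toAffineMap] at hLs hL
  set w := κ.symm z with hw
  set y1 := κ.symm y0 with hy1
  have hκw : κ w = z := by simp [hw]
  have hκy1 : κ y1 = y0 := by simp [hy1]
  let α : E →ᵃ[ℝ] ℝ := (σ i).comp (κ : E →ᵃ[ℝ] E)
  have hα : ∀ y, α y = σ i (κ y) := fun y => rfl
  have hwQ : w ∈ Q := hκ' z (by
    rw [hQ]; refine ⟨hzL, fun j => ?_⟩
    by_cases hj : j = i
    · rw [hj, hzi]
    · exact (hzj j hj).le)
  have hy1Q : y1 ∈ Q := hκ' y0 (by rw [hQ]; exact ⟨h0, fun i => (hpos i).le⟩)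
  have hαw : α w = 0 := by rw [hα, hκw, hzi]
  have hαy1 : 0 < α y1 := by rw [hα, hκy1]; exact hpos i
  have hwQ' := hwQ
  have hy1Q' := hy1Q
  rw [hQ] at hwQ' hy1Q'
  obtain ⟨j, hj⟩ : ∃ j, σ j w = 0 := by
    by_contra! hcon
    obtain ⟨ε, hε, -, h⟩ := cy_eps (fun j => σ j w) (fun j => - (σ j y1 - σ j w))
    have hq : w + (-ε) • (y1 - w) ∈ Q := by
      rw [hQ]
      refine ⟨fun φ hφ => ?_, fun j => ?_⟩
      · rw [cy_aff, hwQ'.1 φ hφ, hy1Q'.1 φ hφ]; simp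
      · rw [cy_aff]
        have := h j (lt_of_le_of_ne (hwQ'.2 j) (hcon j).symm)
        linarith
    rw [← hκ, hQ] at hq
    have h2 := hq.2 i
    rw [← hα, cy_aff, hαw] at h2
    nlinarith
  have hmono : ∀ y, (∀ φ ∈ Φ, φ y = 0) → 0 ≤ α y → 0 ≤ σ j y := by
    intro y hy hαy
    obtain ⟨ε, hε, -, h⟩ := cy_eps (fun j => σ j z) (fun j => σ j (κ y) - σ j z)
    have hq : w + ε • (y - w) ∈ Q := by
      rw [← hκ]
      have e : ∀ φ : E →ᵃ[ℝ] ℝ, φ (κ (w + ε • (y - w))) = φ z + ε * (φ (κ y) - φ z) := by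
        intro φ
        have := cy_aff (φ.comp (κ : E →ᵃ[ℝ] E)) w y ε
        simpa only [AffineMap.comp_apply, AffineEquiv.coe_toAffineMap, hκw] using this
      rw [hQ]
      refine ⟨fun φ hφ => ?_, fun j => ?_⟩
      · rw [e, hzL φ hφ, hL y hy φ hφ]; simp
      · rw [e]
        by_cases hji : j = i
        · rw [hji, hzi, ← hα]; nlinarith
        · exact (h j (hzj j hji)).le
    rw [hQ] at hq
    have h2 := hq.2 j
    rw [cy_aff, hj] at h2
    have h3 : 0 ≤ ε * σ j y := by linarith
    exact nonneg_of_mul_nonneg_right h3 hε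
  have hlin : ∀ y, (∀ φ ∈ Φ, φ y = 0) → σ j y = α y / α y1 * σ j y1 := by
    intro y hy
    have e : ∀ φ : E →ᵃ[ℝ] ℝ, φ (y + (α y / α y1) • (w - y1)) = φ y + α y / α y1 * (φ w - φ y1) := by
      intro φ
      have h1 := φ.map_vadd y ((α y / α y1) • (w - y1))
      have h2 := φ.linearMap_vsub w y1
      simp only [vsub_eq_sub, vadd_eq_add] at h1 h2
      rw [add_comm, h1, map_smul, h2, smul_eq_mul, add_comm]
    set y' := y + (α y / α y1) • (w - y1) with hy'
    have hαy' : α y' = 0 := by rw [e, hαw]; field_simp; ring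
    have hLy' : ∀ φ ∈ Φ, φ y' = 0 := fun φ hφ => by
      rw [e, hy φ hφ, hwQ'.1 φ hφ, hy1Q'.1 φ hφ]; simp
    have a1 := hmono y' hLy' hαy'.ge
    have a2 := hmono (w + (-1 : ℝ) • (y' - w)) (fun φ hφ => by
      rw [cy_aff, hLy' φ hφ, hwQ'.1 φ hφ]; simp) (by rw [cy_aff, hαw, hαy']; simp)
    rw [cy_aff, hj] at a2
    have a3 : σ j y' = 0 := by linarith
    rw [e, hj] at a3
    linarith
  have hp1 : 0 < σ j y1 := by
    refine lt_of_le_of_ne (hy1Q'.2 j) ?_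
    intro hh
    have := hlin y0 h0
    rw [← hh, mul_zero] at this
    exact absurd this (hpos j).ne'
  refine ⟨j, α y1 / σ j y1, by positivity, fun y hy => ?_⟩
  rw [hlin y hy, ← hα]
  field_simp

theorem cy_facet_perm (hQ : Q = {y | (∀ φ ∈ Φ, φ y = 0) ∧ ∀ i, 0 ≤ σ i y})
    {y0 : E} (h0 : ∀ φ ∈ Φ, φ y0 = 0) (hpos : ∀ i, 0 < σ i y0)
    (hz : ∀ i, ∃ z, (∀ φ ∈ Φ, φ z = 0) ∧ σ i z = 0 ∧ ∀ j, j ≠ i → 0 < σ j z)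
    (κ : E ≃ᵃ[ℝ] E) (hκ : ∀ y, κ y ∈ Q ↔ y ∈ Q) :
    ∃ τ : Perm I, ∃ μ : I → ℝ, ∀ i, 0 < μ i ∧
      ∀ y, (∀ φ ∈ Φ, φ y = 0) → σ i (κ y) = μ i * σ (τ i) y := by
  choose τ μ hμ h using cy_facet hQ h0 hpos hz κ hκ
  have hκ' : ∀ y ∈ Q, κ.symm y ∈ Q := fun y hy => by rw [← hκ]; simpa using hy
  have hLs := cy_L hQ h0 hpos (κ.symm : E →ᵃ[ℝ] E) hκ'
  have hinj : Function.Injective τ := by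
    intro i i' hii
    by_contra hne
    obtain ⟨z, hzL, hzi, hzj⟩ := hz i
    have e1 := h i (κ.symm z) (hLs z hzL)
    have e2 := h i' (κ.symm z) (hLs z hzL)
    rw [AffineEquiv.apply_symm_apply] at e1 e2
    rw [hzi, hii] at e1
    have e3 := (mul_eq_zero.1 e1.symm).resolve_left (hμ i).ne'
    rw [e3, mul_zero] at e2
    exact absurd e2 (hzj i' (Ne.symm hne)).ne'
  exact ⟨Equiv.ofBijective τ (Finite.injective_iff_bijective.1 hinj), μ, fun i => ⟨hμ i, h i⟩⟩
end


/-- The set whose supremum normalises the facet functional. -/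
def cyNuSet {d : ℕ} (L : Set (Fin d → ℝ)) (φ : (Fin d → ℝ) → ℝ) : Set ℝ :=
  {r | ∃ y ∈ L, ∃ z ∈ L, ∑ j, (y j - z j) ^ 2 ≤ 1 ∧ r = |φ y - φ z|}

theorem cy_nu_pos {d : ℕ} (L : Set (Fin d → ℝ)) 
    (hL : ∀ y ∈ L, ∀ z ∈ L, ∀ t : ℝ, y + t • (z - y) ∈ L)
    (φ : (Fin d → ℝ) →ᵃ[ℝ] ℝ) (y z : Fin d → ℝ) (hy : y ∈ L) (hz : z ∈ L) (hne : φ y ≠ φ z) :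
    0 < sSup (cyNuSet L φ) := by
  have hb : BddAbove (cyNuSet L φ) := by
    refine ⟨∑ j, |φ.linear (Pi.single j 1)|, ?_⟩
    rintro r ⟨y, -, z, -, h1, rfl⟩
    have e : φ y - φ z = φ.linear (y - z) := by
      simpa using (φ.linearMap_vsub y z).symm
    rw [e, LinearMap.pi_apply_eq_sum_univ φ.linear (y - z)]
    refine (Finset.abs_sum_le_sum_abs _ _).trans (Finset.sum_le_sum fun j _ => ?_)
    rw [smul_eq_mul, abs_mul]
    have h2 : |(y - z) j| ≤ 1 := by
      have := Finset.single_le_sum (f := fun j => (y j - z j) ^ 2) (fun j _ => sq_nonneg _)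
        (Finset.mem_univ j)
      rw [← sq_le_one_iff_abs_le_one]
      exact this.trans h1
    have e2 : (fun k => if j = k then (1 : ℝ) else 0) = Pi.single j 1 := by
      ext k; simp [Pi.single_apply, eq_comm]
    rw [e2]
    exact mul_le_of_le_one_left (abs_nonneg _) h2
  set S := ∑ j, (z j - y j) ^ 2 with hS
  have hS0 : 0 ≤ S := Finset.sum_nonneg fun j _ => sq_nonneg _
  set t : ℝ := 1 / (1 + S) with ht
  have ht0 : 0 < t := by positivity
  have hmem : |φ (y + t • (z - y)) - φ y| ∈ cyNuSet L φ := by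
    refine ⟨_, hL y hy z hz t, y, hy, ?_, rfl⟩
    have : ∑ j, ((y + t • (z - y)) j - y j) ^ 2 = t ^ 2 * S := by
      rw [hS, Finset.mul_sum]
      refine Finset.sum_congr rfl fun j _ => ?_
      simp; ring
    rw [this, ht, div_pow, one_pow, one_div, inv_mul_le_iff₀ (by positivity)]
    nlinarith
  refine lt_of_lt_of_le ?_ (le_csSup hb hmem)
  rw [cy_aff, add_sub_cancel_left, abs_pos]
  exact mul_ne_zero ht0.ne' (sub_ne_zero.2 hne.symm)

open scoped Pointwise in
theorem cy_nu_scale {d : ℕ} (L : Set (Fin d → ℝ)) (φ ψ : (Fin d → ℝ) → ℝ) (μ : ℝ) (hμ : 0 < μ)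
    (κ : (Fin d → ℝ) → (Fin d → ℝ)) (hκL : ∀ y ∈ L, κ y ∈ L) (hκs : ∀ y ∈ L, ∃ z ∈ L, κ z = y)
    (hiso : ∀ y z, ∑ j, (κ y j - κ z j) ^ 2 = ∑ j, (y j - z j) ^ 2)
    (h : ∀ y ∈ L, φ (κ y) = μ * ψ y) :
    sSup (cyNuSet L φ) = μ * sSup (cyNuSet L ψ) := by
  have : cyNuSet L φ = μ • cyNuSet L ψ := by
    ext r
    rw [Set.mem_smul_set]
    constructor
    · rintro ⟨y, hy, z, hz, h1, rfl⟩
      obtain ⟨y, hy', rfl⟩ := hκs y hy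
      obtain ⟨z, hz', rfl⟩ := hκs z hz
      refine ⟨_, ⟨y, hy', z, hz', by rw [← hiso]; exact h1, rfl⟩, ?_⟩
      rw [h y hy', h z hz', ← mul_sub, abs_mul, abs_of_pos hμ, smul_eq_mul]
    · rintro ⟨s, ⟨y, hy, z, hz, h1, rfl⟩, rfl⟩
      refine ⟨_, hκL y hy, _, hκL z hz, by rw [hiso]; exact h1, ?_⟩
      rw [h y hy, h z hz, ← mul_sub, abs_mul, abs_of_pos hμ, smul_eq_mul]
  rw [this, Real.sSup_smul_of_nonneg hμ.le, smul_eq_mul]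

theorem cy_sym {d f : ℕ} (Q : Set (Fin d → ℝ)) (hne : Q.Nonempty) (hdesc : cyDesc Q f) :
    ∃ f' ≤ f, ∃ (Φ : Set ((Fin d → ℝ) →ᵃ[ℝ] ℝ)) (σ : Fin f' → (Fin d → ℝ) →ᵃ[ℝ] ℝ),
      Q = {y | (∀ φ ∈ Φ, φ y = 0) ∧ ∀ i, 0 ≤ σ i y} ∧
      ∀ (κ : (Fin d → ℝ) ≃ᵃ[ℝ] (Fin d → ℝ)), (∀ y, κ y ∈ Q ↔ y ∈ Q) →
        (∀ y z, ∑ j, (κ y j - κ z j) ^ 2 = ∑ j, (y j - z j) ^ 2) → 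
        ∃ τ : Perm (Fin f'), ∀ i, ∀ y ∈ Q, σ i (κ y) = σ (τ i) y := by
  classical
  have hex : ∃ f, cyDesc Q f := ⟨f, hdesc⟩
  obtain ⟨Φ, σ, hQ⟩ := Nat.find_spec hex
  refine ⟨Nat.find hex, Nat.find_min' hex hdesc, Φ, ?_⟩
  obtain ⟨y0, h0, hpos, hz⟩ := cy_min2 Q hne _ Φ σ (fun f' hf' => Nat.find_min hex hf') hQ
  let L : Set (Fin d → ℝ) := {y | ∀ φ ∈ Φ, φ y = 0}
  have hL : ∀ y ∈ L, ∀ z ∈ L, ∀ t : ℝ, y + t • (z - y) ∈ L := by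
    intro y hy z hz t φ hφ
    rw [cy_aff, hy φ hφ, hz φ hφ]; simp
  have hν : ∀ i, 0 < sSup (cyNuSet L (σ i)) := by
    intro i
    obtain ⟨z, hzL, hzi, hzj⟩ := hz i
    exact cy_nu_pos L hL (σ i) y0 z h0 hzL (by rw [hzi]; exact (hpos i).ne')
  refine ⟨fun i => (sSup (cyNuSet L (σ i)))⁻¹ • σ i, ?_, ?_⟩
  · refine hQ.trans ?_
    ext y
    refine and_congr Iff.rfl (forall_congr' fun i => ?_)
    change _ ↔ 0 ≤ (sSup (cyNuSet L (σ i)))⁻¹ * σ i y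
    rw [mul_nonneg_iff_of_pos_left (inv_pos.2 (hν i))]
  · intro κ hκ hiso
    obtain ⟨τ, μ, h⟩ := cy_facet_perm hQ h0 hpos hz κ hκ
    refine ⟨τ, fun i y hy => ?_⟩
    have hκ' : ∀ y ∈ Q, κ.symm y ∈ Q := fun y hy => by rw [← hκ]; simpa using hy
    have hLs := cy_L hQ h0 hpos (κ.symm : (Fin d → ℝ) →ᵃ[ℝ] (Fin d → ℝ)) hκ'
    have hLL := cy_L hQ h0 hpos (κ : (Fin d → ℝ) →ᵃ[ℝ] (Fin d → ℝ)) (fun y hy => (hκ y).2 hy)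
    have e := cy_nu_scale L (σ i) (σ (τ i)) (μ i) (h i).1 κ (fun y hy => hLL y hy)
      (fun y hy => ⟨κ.symm y, hLs y hy, by simp⟩) hiso (fun y hy => (h i).2 y hy)
    rw [hQ] at hy
    change (sSup (cyNuSet L (σ i)))⁻¹ * σ i (κ y) = (sSup (cyNuSet L (σ (τ i))))⁻¹ * σ (τ i) y
    rw [(h i).2 y hy.1, e]
    have := (h i).1
    have := hν (τ i)
    field_simp

/-- Affine isometry from an orthogonal matrix. -/
theorem cy_matrix {d : ℕ} (U : Matrix (Fin d) (Fin d) ℝ) (u : Fin d → ℝ)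
    (hU : U * U.transpose = 1) :
    ∃ κ : (Fin d → ℝ) ≃ᵃ[ℝ] (Fin d → ℝ), (∀ y, κ y = U.mulVec y + u) ∧
      ∀ y z, ∑ j, (κ y j - κ z j) ^ 2 = ∑ j, (y j - z j) ^ 2 := by
  have hU' : U.transpose * U = 1 := mul_eq_one_comm.1 hU
  let e : (Fin d → ℝ) ≃ₗ[ℝ] (Fin d → ℝ) := Matrix.toLin'OfInv hU' hU
  refine ⟨e.toAffineEquiv.trans (AffineEquiv.constVAdd ℝ _ u), ?_, ?_⟩
  · intro y
    simp [e, add_comm, Matrix.toLin'OfInv]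
  · intro y z
    have h1 : ∀ y z j, (e.toAffineEquiv.trans (AffineEquiv.constVAdd ℝ _ u)) y j
        - (e.toAffineEquiv.trans (AffineEquiv.constVAdd ℝ _ u)) z j = U.mulVec (y - z) j := by
      intro y z j
      simp [e, Matrix.mulVec_sub, Matrix.toLin'OfInv]
    simp_rw [h1]
    have h2 : ∀ v : Fin d → ℝ, ∑ j, v j ^ 2 = v ⬝ᵥ v := fun v => by
      simp [dotProduct, sq]
    have h3 := h2 (y - z)
    simp only [Pi.sub_apply] at h3
    rw [h2, h3, Matrix.dotProduct_mulVec, Matrix.vecMul_mulVec, hU', Matrix.vecMul_one]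



section
variable {E X H : Type*} [AddCommGroup E] [Module ℝ E] [AddCommGroup X] [Module ℝ X]
  [Group H] [Fintype H] {I : Type} [Fintype I] 

/-- The group of compatible pairs (facet permutation, node permutation). -/
def cyGam (Q : Set E) (p : E →ᵃ[ℝ] X) (σ : I → E →ᵃ[ℝ] ℝ) (act : H → X → X)
    (h1 : ∀ x, act 1 x = x) (hm : ∀ a b x, act (a * b) x = act a (act b x)) :
    Submonoid (Perm I × H) where
  carrier := {g | ∃ κ : E → E, (∀ y ∈ Q, κ y ∈ Q) ∧ (∀ y ∈ Q, p (κ y) = act g.2 (p y)) ∧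
    ∀ i, ∀ y ∈ Q, σ i (κ y) = σ (g.1⁻¹ i) y}
  one_mem' := ⟨id, fun y hy => hy, fun y _ => (h1 _).symm, fun i y _ => rfl⟩
  mul_mem' := by
    rintro a b ⟨κ1, a1, a2, a3⟩ ⟨κ2, b1, b2, b3⟩
    refine ⟨κ1 ∘ κ2, fun y hy => a1 _ (b1 y hy), fun y hy => ?_, fun i y hy => ?_⟩
    · simp only [Function.comp]; rw [a2 _ (b1 y hy), b2 y hy, Prod.snd_mul, hm]
    · simp only [Function.comp]; rw [a3 i _ (b1 y hy), b3 _ y hy, Prod.fst_mul, mul_inv_rev]; rfl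

theorem cy_inv_mem {M : Type*} [Group M] [Finite M] (S : Submonoid M) {x : M} (hx : x ∈ S) :
    x⁻¹ ∈ S := by
  have : x⁻¹ = x ^ (orderOf x - 1) := by
    rw [inv_eq_iff_mul_eq_one, ← pow_succ', Nat.sub_add_cancel (orderOf_pos x), pow_orderOf_eq_one]
  rw [this]; exact S.pow_mem hx _

open Classical in
theorem cy_avg (Q : Set E) (hQc : ∀ (s : Finset (Perm I × H)) (w : Perm I × H → ℝ)
      (y : Perm I × H → E), (∀ i ∈ s, 0 ≤ w i) → ∑ i ∈ s, w i = 1 → (∀ i ∈ s, y i ∈ Q) →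
      ∑ i ∈ s, w i • y i ∈ Q)
    (p : E →ᵃ[ℝ] X) (σ : I → E →ᵃ[ℝ] ℝ) (act : H → X → X)
    (h1 : ∀ x, act 1 x = x) (hm : ∀ a b x, act (a * b) x = act a (act b x))
    (hsym : ∀ π : H, ∃ κ : E → E, ∃ τ : Perm I, (∀ y ∈ Q, κ y ∈ Q) ∧
      (∀ y ∈ Q, p (κ y) = act π (p y)) ∧ ∀ i, ∀ y ∈ Q, σ i (κ y) = σ (τ i) y)
    (y0 : E) (hy0 : y0 ∈ Q) :
    ∃ Y : H → E, (∀ π, Y π ∈ Q) ∧ (∀ π, p (Y π) = act π (p y0)) ∧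
      ∀ i, ∃ G : Subgroup H, ∃ col : H → I, (∀ g g', col g = col g' → g⁻¹ * g' ∈ G) ∧
        ∀ u ∈ G, ∀ π, σ i (Y (u * π)) = σ i (Y π) := by
  set Γ := cyGam Q p σ act h1 hm with hΓ
  have hs : ∀ π : H, ∃ θ : Perm I, (θ, π) ∈ Γ := by
    intro π
    obtain ⟨κ, τ, a, b, c⟩ := hsym π
    exact ⟨τ⁻¹, κ, a, b, by simpa using c⟩
  choose θ hθ using hs
  have hκ : ∀ g : Perm I × H, ∃ κ : E → E, g ∈ Γ → ((∀ y ∈ Q, κ y ∈ Q) ∧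
      (∀ y ∈ Q, p (κ y) = act g.2 (p y)) ∧ ∀ i, ∀ y ∈ Q, σ i (κ y) = σ (g.1⁻¹ i) y) := by
    intro g
    by_cases hg : g ∈ Γ
    · obtain ⟨κ, h⟩ := hg
      exact ⟨κ, fun _ => h⟩
    · exact ⟨id, fun h => absurd h hg⟩
  choose κ hκ using hκ
  let S : H → Finset (Perm I × H) := fun π => Finset.univ.filter (fun g => g ∈ Γ ∧ g.2 = π)
  have hSmem : ∀ π g, g ∈ S π ↔ g ∈ Γ ∧ g.2 = π := fun π g => by simp [S]
  have hSne : ∀ π, (0 : ℝ) < (S π).card := fun π => by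
    have : 0 < (S π).card := Finset.card_pos.2 ⟨(θ π, π), by simp [hSmem, hθ]⟩
    exact_mod_cast this
  have hw : ∀ π, ∑ g ∈ S π, ((S π).card : ℝ)⁻¹ = 1 := fun π => by
    rw [Finset.sum_const, nsmul_eq_mul, mul_inv_cancel₀ (hSne π).ne']
  let Y : H → E := fun π => ∑ g ∈ S π, ((S π).card : ℝ)⁻¹ • κ g y0
  refine ⟨Y, ?_, ?_, ?_⟩
  · intro π
    refine hQc _ (fun _ => ((S π).card : ℝ)⁻¹) (fun g => κ g y0) (fun _ _ => by positivity) (hw π) ?_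
    intro g hg
    exact (hκ g ((hSmem _ _).1 hg).1).1 _ hy0
  · intro π
    rw [cy_affsum p _ (fun _ => ((S π).card : ℝ)⁻¹) (hw π)]
    have : ∀ g ∈ S π, ((S π).card : ℝ)⁻¹ • p (κ g y0) = ((S π).card : ℝ)⁻¹ • act π (p y0) := by
      intro g hg
      obtain ⟨hg1, hg2⟩ := (hSmem _ _).1 hg
      rw [(hκ g hg1).2.1 _ hy0, hg2]
    rw [Finset.sum_congr rfl this, ← Finset.sum_smul, hw, one_smul]
  · intro i
    have hσ : ∀ π, σ i (Y π) = ∑ g ∈ S π, ((S π).card : ℝ)⁻¹ * σ (g.1⁻¹ i) y0 := by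
      intro π
      rw [cy_affsum (σ i) _ (fun _ => ((S π).card : ℝ)⁻¹) (hw π)]
      refine Finset.sum_congr rfl fun g hg => ?_
      rw [(hκ g ((hSmem _ _).1 hg).1).2.2 _ _ hy0, smul_eq_mul]
    let G : Subgroup H :=
      { carrier := {π | ∃ θ : Perm I, (θ, π) ∈ Γ ∧ θ i = i}
        one_mem' := ⟨1, Γ.one_mem, rfl⟩
        mul_mem' := by
          rintro a b ⟨t, ht, hti⟩ ⟨t', ht', hti'⟩
          exact ⟨t * t', Γ.mul_mem ht ht', by rw [Perm.mul_apply, hti', hti]⟩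
        inv_mem' := by
          rintro a ⟨t, ht, hti⟩
          exact ⟨t⁻¹, cy_inv_mem Γ ht, by rw [Perm.inv_eq_iff_eq, hti]⟩ }
    refine ⟨G, fun π => θ π i, ?_, ?_⟩
    · intro g g' hgg
      refine ⟨(θ g)⁻¹ * θ g', Γ.mul_mem (cy_inv_mem Γ (hθ g)) (hθ g'), ?_⟩
      rw [Perm.mul_apply, Perm.inv_eq_iff_eq]
      exact hgg.symm
    · rintro u ⟨t, ht, hti⟩ π
      have hSS : S (u * π) = (S π).map (Equiv.mulLeft ((t, u) : Perm I × H)).toEmbedding := by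
        ext g
        rw [Finset.mem_map_equiv, hSmem, hSmem]
        simp only [Equiv.mulLeft_symm, Equiv.coe_mulLeft]
        constructor
        · rintro ⟨a, b⟩
          exact ⟨Γ.mul_mem (cy_inv_mem Γ ht) a, by simp [b]⟩
        · rintro ⟨a, b⟩
          have := Γ.mul_mem ht a
          rw [mul_inv_cancel_left] at this
          refine ⟨this, ?_⟩
          simp only [Prod.snd_mul, Prod.snd_inv] at b
          rw [← b]; simp
      rw [hσ, hσ, hSS, Finset.sum_map, Finset.card_map]
      refine Finset.sum_congr rfl fun g _ => ?_
      congr 2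
      simp only [Equiv.coe_toEmbedding, Equiv.coe_mulLeft, Prod.fst_mul, mul_inv_rev,
        Perm.mul_apply]
      congr 1
      rw [Perm.inv_eq_iff_eq.2 hti.symm]
end


theorem cy_u {W : Type*} [DecidableEq W] (col : W → Bool) (F : Finset W) (x y x' y' : W)
    (hxy : x ≠ y) (hxy' : x' ≠ y') (hx : col x' = col x) (hy : col y' = col y)
    (h1 : x ∉ F) (h2 : y ∉ F) (h3 : x' ∉ F) (h4 : y' ∉ F) :
    ∃ u : Perm W, u x' = x ∧ u y' = y ∧ (∀ w, col (u w) = col w) ∧ ∀ w ∈ F, u w = w := by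
  have hsw : ∀ a b : W, col a = col b → ∀ w, col (swap a b w) = col w := by
    intro a b hab w
    rcases swap_apply_eq_iff.1 (rfl : swap a b w = swap a b w) with h
    by_cases ha : w = a
    · subst ha; simp [hab]
    · by_cases hb : w = b
      · subst hb; simp [hab]
      · rw [swap_apply_of_ne_of_ne ha hb]
  have hsF : ∀ a b : W, a ∉ F → b ∉ F → ∀ w ∈ F, swap a b w = w := by
    intro a b ha hb w hw
    exact swap_apply_of_ne_of_ne (fun h => ha (h ▸ hw)) (fun h => hb (h ▸ hw))
  set y1 := swap x x' y' with hy1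
  have hy1x : y1 ≠ x := by
    intro h
    have : swap x x' y' = swap x x' x' := by rw [← hy1, h]; simp
    exact hxy' ((swap x x').injective this).symm
  have hy1F : y1 ∉ F := by
    rw [hy1]
    intro h
    have := hsF x x' h1 h3 _ h
    simp at this
    rw [← this] at h
    exact h4 h
  have hy1c : col y1 = col y := by rw [hy1, hsw x x' hx.symm, hy]
  refine ⟨swap y1 y * swap x x', ?_, ?_, ?_, ?_⟩
  · simp [swap_apply_of_ne_of_ne hy1x.symm hxy]
  · simp [← hy1]
  · intro w; simp [hsw y1 y hy1c, hsw x x' hx.symm]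
  · intro w hw; simp [hsF x x' h1 h3 w hw, hsF y1 y hy1F h2 w hw]

section
variable {ι : Type} [Fintype ι] [DecidableEq ι]

def cyTy (e : Perm (ι × Bool)) (t : ι) : Bool × Bool := ((e (t, false)).2, (e (t, true)).2)

def cyE (ι : Type) [Fintype ι] [DecidableEq ι] (a : Bool × Bool → ℕ) :
    Finset (Perm (ι × Bool)) :=
  Finset.univ.filter (fun e => ∀ θ, (Finset.univ.filter (fun t => cyTy e t = θ)).card = a θ)

def cyM (a : Bool × Bool → ℕ) (T : Finset ι) (c : ι → (ι × Bool) × (ι × Bool)) :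
    Finset (Perm (ι × Bool)) :=
  (cyE ι a).filter (fun e => ∀ t ∈ T, e (t, false) = (c t).1 ∧ e (t, true) = (c t).2)

theorem cy_invar (a : Bool × Bool → ℕ) (T : Finset ι) (c : ι → (ι × Bool) × (ι × Bool))
    (F : Finset (ι × Bool)) (hF : ∀ s ∈ T, (c s).1 ∈ F ∧ (c s).2 ∈ F)
    (t t' : ι) (ht : t ∉ T) (ht' : t' ∉ T) (x y x' y' : ι × Bool)
    (hxy : x ≠ y) (hxy' : x' ≠ y') (hx : x'.2 = x.2) (hy : y'.2 = y.2)
    (h1 : x ∉ F) (h2 : y ∉ F) (h3 : x' ∉ F) (h4 : y' ∉ F) :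
    ((cyM a T c).filter (fun e => e (t', false) = x' ∧ e (t', true) = y')).card =
    ((cyM a T c).filter (fun e => e (t, false) = x ∧ e (t, true) = y)).card := by
  obtain ⟨u, ux, uy, uc, uF⟩ := cy_u (fun w : ι × Bool => w.2) F x y x' y' hxy hxy' hx hy h1 h2 h3 h4
  let v : Perm ι := swap t t'
  let s : Perm (ι × Bool) := Equiv.prodCongr v (Equiv.refl _)
  have hs : ∀ t b, s (t, b) = (v t, b) := fun t b => rfl
  let φ : Perm (Perm (ι × Bool)) := (Equiv.mulLeft u).trans (Equiv.mulRight s)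
  have hφ : ∀ e w, φ e w = u (e (s w)) := fun e w => rfl
  refine Finset.card_equiv φ ?_
  intro e
  have hE : e ∈ cyE ι a ↔ φ e ∈ cyE ι a := by
    simp only [cyE, Finset.mem_filter, Finset.mem_univ, true_and]
    refine forall_congr' fun θ => ?_
    have : (Finset.univ.filter (fun t => cyTy (φ e) t = θ)).card
        = (Finset.univ.filter (fun t => cyTy e t = θ)).card := by
      refine Finset.card_equiv v fun t => ?_
      rw [Finset.mem_filter, Finset.mem_filter]
      simp only [Finset.mem_univ, true_and, cyTy, hφ, hs, uc]
    rw [this]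
  simp only [cyM, Finset.mem_filter]
  rw [← hE]
  refine and_congr (and_congr Iff.rfl ?_) ?_
  · refine forall_congr' fun r => forall_congr' fun hr => ?_
    have hvr : v r = r := swap_apply_of_ne_of_ne (fun h => ht (h ▸ hr)) (fun h => ht' (h ▸ hr))
    rw [hφ, hφ, hs, hs, hvr]
    have e1 := uF _ (hF r hr).1
    have e2 := uF _ (hF r hr).2
    constructor
    · rintro ⟨a, b⟩; rw [a, b, e1, e2]; exact ⟨rfl, rfl⟩
    · rintro ⟨a, b⟩
      exact ⟨u.injective (a.trans e1.symm), u.injective (b.trans e2.symm)⟩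
  · have hvt : v t = t' := swap_apply_left _ _
    rw [hφ, hφ, hs, hs, hvt]
    constructor
    · rintro ⟨a, b⟩; rw [a, b, ux, uy]; exact ⟨rfl, rfl⟩
    · rintro ⟨a, b⟩
      exact ⟨u.injective (a.trans ux.symm), u.injective (b.trans uy.symm)⟩

theorem cyM_insert (a : Bool × Bool → ℕ) (T : Finset ι) (c : ι → (ι × Bool) × (ι × Bool)) (t : ι) :
    cyM a (insert t T) c =
      (cyM a T c).filter (fun e => e (t, false) = (c t).1 ∧ e (t, true) = (c t).2) := by
  ext e
  simp only [cyM, Finset.mem_filter, Finset.forall_mem_insert]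
  tauto

theorem cy_rec (T : Finset ι) (c : ι → (ι × Bool) × (ι × Bool)) (t : ι) (ht : t ∉ T) :
    (∀ a, (cyM a (insert t T) c).card = 0) ∨ ∃ D : ℕ, 0 < D ∧ ∀ a,
      (cyM a (insert t T) c).card * D +
      (T.filter (fun s => ((c s).1.2, (c s).2.2) = ((c t).1.2, (c t).2.2))).card * (cyM a T c).card
      = a ((c t).1.2, (c t).2.2) * (cyM a T c).card := by
  set F : Finset (ι × Bool) := T.biUnion (fun s => {(c s).1, (c s).2}) with hFdef
  have hF : ∀ s ∈ T, (c s).1 ∈ F ∧ (c s).2 ∈ F := fun s hs => by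
    constructor <;> exact Finset.mem_biUnion.2 ⟨s, hs, by simp⟩
  -- labels in F are used on T
  have hFe : ∀ a, ∀ e ∈ cyM a T c, ∀ t' ∉ T, ∀ b, e (t', b) ∉ F := by
    intro a e he t' ht' b hb
    obtain ⟨s, hs, hb⟩ := Finset.mem_biUnion.1 hb
    have h := (Finset.mem_filter.1 he).2 s hs
    simp only [Finset.mem_insert, Finset.mem_singleton] at hb
    rcases hb with hb | hb
    · rw [← h.1] at hb
      have := e.injective hb
      simp only [Prod.mk.injEq] at this
      exact ht' (this.1 ▸ hs)
    · rw [← h.2] at hb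
      have := e.injective hb
      simp only [Prod.mk.injEq] at this
      exact ht' (this.1 ▸ hs)
  have hne : ∀ e : Perm (ι × Bool), ∀ t' : ι, e (t', false) ≠ e (t', true) := by
    intro e t' h
    have := e.injective h
    simp at this
  by_cases hbad : (c t).1 = (c t).2 ∨ (c t).1 ∈ F ∨ (c t).2 ∈ F
  · left
    intro a
    rw [Finset.card_eq_zero, cyM_insert, Finset.filter_eq_empty_iff]
    rintro e he ⟨h1, h2⟩
    rcases hbad with h | h | h
    · exact hne e t (by rw [h1, h2, h])
    · rw [← h1] at h; exact hFe a e he t ht _ h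
    · rw [← h2] at h; exact hFe a e he t ht _ h
  right
  push Not at hbad
  obtain ⟨b1, b2, b3⟩ := hbad
  set θ : Bool × Bool := ((c t).1.2, (c t).2.2) with hθ
  let Av : Finset ((ι × Bool) × (ι × Bool)) := Finset.univ.filter (fun q =>
    q.1 ≠ q.2 ∧ q.1 ∉ F ∧ q.2 ∉ F ∧ (q.1.2, q.2.2) = θ)
  have hAv : c t ∈ Av := by simp [Av, b1, b2, b3, hθ]
  refine ⟨(Tᶜ ×ˢ Av).card, Finset.card_pos.2 ⟨(t, c t), by simp [ht, hAv]⟩, fun a => ?_⟩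
  have count2 : ∑ e ∈ cyM a T c, ((Tᶜ).filter (fun t' => cyTy e t' = θ)).card
      = (cyM a (insert t T) c).card * (Tᶜ ×ˢ Av).card := by
    have e1 : ∀ e ∈ cyM a T c, ((Tᶜ).filter (fun t' => cyTy e t' = θ)).card =
        ∑ q ∈ Tᶜ ×ˢ Av, if e (q.1, false) = q.2.1 ∧ e (q.1, true) = q.2.2 then 1 else 0 := by
      intro e he
      rw [Finset.card_filter, Finset.sum_product]
      refine Finset.sum_congr rfl fun t' ht' => ?_
      have ht'' : t' ∉ T := by simpa using ht'
      split_ifs with hty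
      · rw [Finset.sum_eq_single (e (t', false), e (t', true))]
        · simp
        · rintro ⟨x', y'⟩ _ hq
          rw [if_neg]
          rintro ⟨h1, h2⟩
          exact hq (by simp_all)
        · intro h
          exfalso; apply h
          simp only [Av, Finset.mem_filter, Finset.mem_univ, true_and]
          exact ⟨hne e t', hFe a e he t' ht'' _, hFe a e he t' ht'' _, hty⟩
      · symm
        apply Finset.sum_eq_zero
        rintro ⟨x', y'⟩ hq
        rw [if_neg]
        rintro ⟨h1, h2⟩
        simp only [Av, Finset.mem_filter, Finset.mem_univ, true_and] at hq
        apply hty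
        simp only at h1 h2
        rw [cyTy, h1, h2]; exact hq.2.2.2
    rw [Finset.sum_congr rfl e1, Finset.sum_comm, mul_comm, ← smul_eq_mul, ← Finset.sum_const]
    refine Finset.sum_congr rfl fun q hq => ?_
    rw [← Finset.card_filter, cyM_insert]
    simp only [Av, Finset.mem_product, Finset.mem_compl, Finset.mem_filter, Finset.mem_univ,
      true_and] at hq
    obtain ⟨q1, q2, q3, q4, q5⟩ := hq
    simp only [hθ, Prod.mk.injEq] at q5
    exact cy_invar a T c F hF t q.1 ht q1 _ _ _ _ b1 q2 q5.1 q5.2 b2 b3 q3 q4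
  rw [← count2]
  have count1 : ∀ e ∈ cyM a T c, ((Tᶜ).filter (fun t' => cyTy e t' = θ)).card +
      (T.filter (fun s => ((c s).1.2, (c s).2.2) = θ)).card = a θ := by
    intro e he
    have he' := Finset.mem_filter.1 he
    have h1 := (Finset.mem_filter.1 he'.1).2 θ
    have h2 : T.filter (fun s => ((c s).1.2, (c s).2.2) = θ) = T.filter (fun t' => cyTy e t' = θ) := by
      refine Finset.filter_congr fun s hs => ?_
      rw [cyTy, (he'.2 s hs).1, (he'.2 s hs).2]
    rw [h2, ← h1, ← Finset.card_union_of_disjoint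
      (Finset.disjoint_filter_filter (disjoint_compl_left)), ← Finset.filter_union]
    congr 2
    ext; simp [em']
  rw [mul_comm (Finset.card _) (cyM a T c).card, mul_comm (a θ), ← smul_eq_mul, ← smul_eq_mul,
    ← Finset.sum_const, ← Finset.sum_const, ← Finset.sum_add_distrib]
  exact Finset.sum_congr rfl count1
end


/-- Slot pairs. -/
abbrev cyI (K : ℕ) := Option (Fin K × Bool)

def cyA (K r : ℕ) : Bool × Bool → ℕ
  | (false, false) => r
  | (true, true) => r
  | (false, true) => 2 * K + 1 - 2 * r
  | (true, false) => 0

noncomputable def cyP (K : ℕ) : Bool × Bool → Polynomial ℝ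
  | (false, false) => Polynomial.X
  | (true, true) => Polynomial.X
  | (false, true) => Polynomial.C (2 * K + 1 : ℝ) - Polynomial.C 2 * Polynomial.X
  | (true, false) => 0

theorem cyP_deg (K : ℕ) (θ : Bool × Bool) : (cyP K θ).natDegree ≤ 1 := by
  rcases θ with ⟨a, b⟩
  cases a <;> cases b <;> simp only [cyP]
  · simp
  · compute_degree
  · simp
  · simp

theorem cyP_eval (K r : ℕ) (hr : r ≤ K) (θ : Bool × Bool) : (cyP K θ).eval (r : ℝ) = cyA K r θ := by
  rcases θ with ⟨a, b⟩
  cases a <;> cases b <;> simp only [cyP, cyA]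
  · simp
  · rw [Nat.cast_sub (by lia)]; simp
  · simp
  · simp

theorem cyP_half (K : ℕ) (θ : Bool × Bool) :
    (cyP K θ).eval ((2 * K + 1 : ℝ) / 2) = if θ.1 = θ.2 then (2 * K + 1 : ℝ) / 2 else 0 := by
  rcases θ with ⟨a, b⟩
  cases a <;> cases b <;> simp [cyP]
  ring

/-- Explicit arrangement with `r` monochromatic pairs of each colour. -/
def cyArr (K r : ℕ) : cyI K × Bool → cyI K × Bool
  | (none, c) => (none, c)
  | (some (s, b), c) => if s.1 < r then (some (s, c), b) else (some (s, b), c)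

theorem cyArr_inv (K r : ℕ) : Function.Involutive (cyArr K r) := by
  rintro ⟨_ | ⟨s, b⟩, c⟩
  · rfl
  · by_cases h : s.1 < r <;> simp [cyArr, h]

theorem cyE_nonempty (K r : ℕ) (hr : r ≤ K) : (cyE (cyI K) (cyA K r)).Nonempty := by
  refine ⟨(cyArr_inv K r).toPerm, ?_⟩
  simp only [cyE, Finset.mem_filter, Finset.mem_univ, true_and]
  have h1 : ∑ s : Fin K, (if s.1 < r then 1 else 0) = r := by
    rw [← Finset.card_filter, Fin.card_filter_val_lt]; lia
  have h2 : ∑ s : Fin K, (if s.1 < r then 0 else 1) = K - r := by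
    have : ∑ s : Fin K, (if s.1 < r then 0 else 1) + ∑ s : Fin K, (if s.1 < r then 1 else 0) = K := by
      rw [← Finset.sum_add_distrib]
      rw [Finset.sum_congr rfl (g := fun _ => 1) (fun s _ => by split_ifs <;> rfl)]
      simp
    lia
  have hty : ∀ (s : Fin K) b, cyTy (cyArr_inv K r).toPerm (some (s, b)) =
      if s.1 < r then (b, b) else (false, true) := by
    intro s b
    by_cases h : s.1 < r <;> simp [cyTy, cyArr, h]
  have hty0 : cyTy (cyArr_inv K r).toPerm none = (false, true) := by
    simp [cyTy, cyArr]
  have h3 : ∀ (b : Bool) (θ : Bool × Bool),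
      ∑ s : Fin K, (if (if s.1 < r then (b, b) else (false, true)) = θ then 1 else 0) =
      r * (if (b, b) = θ then 1 else 0) + (K - r) * (if (false, true) = θ then 1 else 0) := by
    intro b θ
    refine Eq.trans ?_ (congrArg₂ (fun x y => x * (if (b, b) = θ then 1 else 0) +
      y * (if (false, true) = θ then 1 else 0)) h1 h2)
    rw [Finset.sum_mul, Finset.sum_mul, ← Finset.sum_add_distrib]
    refine Finset.sum_congr rfl fun s _ => ?_
    by_cases h : s.1 < r <;> simp [h]
  intro θ
  rw [Finset.card_filter, Fintype.sum_option, Fintype.sum_prod_type]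
  simp only [Fintype.sum_bool, hty, hty0, Finset.sum_add_distrib, h3]
  rcases θ with ⟨a, b⟩
  cases a <;> cases b
  · simp [cyA]
  · simp [cyA]; lia
  · simp [cyA]
  · simp [cyA]

theorem cy_poly (K : ℕ) (c : cyI K → (cyI K × Bool) × (cyI K × Bool)) (T : Finset (cyI K)) :
    T.card ≤ K → ∃ q : Polynomial ℝ, q.natDegree ≤ T.card ∧
      (∀ r ≤ K, ((cyM (cyA K r) T c).card : ℝ) = q.eval (r : ℝ) * (cyE (cyI K) (cyA K r)).card) ∧
      0 ≤ q.eval ((2 * K + 1 : ℝ) / 2) ∧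
      ((∃ t ∈ T, (c t).1.2 ≠ (c t).2.2) → q.eval ((2 * K + 1 : ℝ) / 2) = 0) := by
  induction T using Finset.induction_on with
  | empty =>
    intro _
    refine ⟨1, by simp, fun r hr => by simp [cyM], by simp, by simp⟩
  | insert t T ht ih =>
    intro hc
    rw [Finset.card_insert_of_notMem ht] at hc ⊢
    obtain ⟨q, hq1, hq2, hq3, hq4⟩ := ih (by lia)
    rcases cy_rec T c t ht with h | ⟨D, hD, h⟩
    · refine ⟨0, by simp, fun r hr => by rw [h]; simp, by simp, by simp⟩
    set θ : Bool × Bool := ((c t).1.2, (c t).2.2) with hθ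
    set κ := (T.filter (fun s => ((c s).1.2, (c s).2.2) = θ)).card with hκ
    have hD' : (0 : ℝ) < D := by exact_mod_cast hD
    refine ⟨Polynomial.C ((D : ℝ)⁻¹) * ((cyP K θ - Polynomial.C (κ : ℝ)) * q), ?_, ?_, ?_, ?_⟩
    · refine (Polynomial.natDegree_C_mul_le _ _).trans (Polynomial.natDegree_mul_le.trans ?_)
      have := Polynomial.natDegree_sub_le (cyP K θ) (Polynomial.C (κ : ℝ))
      simp only [Polynomial.natDegree_C] at this
      have h1 := cyP_deg K θ
      have : (cyP K θ - Polynomial.C (κ : ℝ)).natDegree ≤ 1 := this.trans (max_le h1 (by simp))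
      lia
    · intro r hr
      have e := h (cyA K r)
      have e' : ((cyM (cyA K r) (insert t T) c).card : ℝ) * D + κ * (cyM (cyA K r) T c).card
          = cyA K r θ * (cyM (cyA K r) T c).card := by exact_mod_cast e
      rw [hq2 r hr] at e'
      simp only [Polynomial.eval_mul, Polynomial.eval_C, Polynomial.eval_sub]
      rw [cyP_eval K r hr]
      field_simp
      linarith
    · simp only [Polynomial.eval_mul, Polynomial.eval_C, Polynomial.eval_sub]
      rw [cyP_half]
      split_ifs with hm
      · have h1 : κ ≤ T.card := Finset.card_filter_le _ _
        have h2 : (κ : ℝ) ≤ K := by exact_mod_cast h1.trans (by lia)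
        refine mul_nonneg (inv_nonneg.2 hD'.le) (mul_nonneg ?_ hq3)
        linarith
      · by_cases hk : κ = 0
        · rw [hk]; simp
        · obtain ⟨s, hs⟩ := Finset.card_pos.1 (Nat.pos_of_ne_zero hk)
          simp only [Finset.mem_filter, hθ, Prod.mk.injEq] at hs
          rw [hq4 ⟨s, hs.1, by rw [hs.2.1, hs.2.2]; exact hm⟩]
          simp
    · rintro ⟨s, hs, hmix⟩
      simp only [Polynomial.eval_mul, Polynomial.eval_C, Polynomial.eval_sub]
      rcases Finset.mem_insert.1 hs with rfl | hs
      · rw [cyP_half, if_neg hmix]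
        by_cases hk : κ = 0
        · rw [hk]; simp
        · obtain ⟨s, hs⟩ := Finset.card_pos.1 (Nat.pos_of_ne_zero hk)
          simp only [Finset.mem_filter, hθ, Prod.mk.injEq] at hs
          rw [hq4 ⟨s, hs.1, by rw [hs.2.1, hs.2.2]; exact hmix⟩]
          simp
      · rw [hq4 ⟨s, hs, hmix⟩]; simp

theorem cy_mu (K : ℕ) : ∃ μ : Perm (cyI K × Bool) → ℝ, ∑ e, μ e = 1 ∧
    ∀ (T : Finset (cyI K)) (c : cyI K → (cyI K × Bool) × (cyI K × Bool)), T.card ≤ K →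
      0 ≤ ∑ e with (∀ t ∈ T, e (t, false) = (c t).1 ∧ e (t, true) = (c t).2), μ e ∧
      ((∃ t ∈ T, (c t).1.2 ≠ (c t).2.2) →
        ∑ e with (∀ t ∈ T, e (t, false) = (c t).1 ∧ e (t, true) = (c t).2), μ e = 0) := by
  let s := Finset.range (K + 1)
  let v : ℕ → ℝ := fun r => (r : ℝ)
  have hv : Set.InjOn v s := fun a _ b _ h => by simpa [v] using h
  let x : ℝ := (2 * K + 1 : ℝ) / 2
  let lam : ℕ → ℝ := fun r => (Lagrange.basis s v r).eval x
  have hlam : ∀ q : Polynomial ℝ, q.natDegree ≤ K → ∑ r ∈ s, lam r * q.eval (r : ℝ) = q.eval x := by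
    intro q hq
    have hdeg : q.degree < s.card := by
      rw [Finset.card_range]
      exact lt_of_le_of_lt Polynomial.degree_le_natDegree (by exact_mod_cast Nat.lt_succ_of_le hq)
    conv_rhs => rw [Lagrange.eq_interpolate hv hdeg, Lagrange.interpolate_apply,
      Polynomial.eval_finsetSum]
    refine Finset.sum_congr rfl fun r _ => ?_
    rw [Polynomial.eval_mul, Polynomial.eval_C, mul_comm]
  let μ : Perm (cyI K × Bool) → ℝ := fun e => ∑ r ∈ s, lam r *
    (if e ∈ cyE (cyI K) (cyA K r) then ((cyE (cyI K) (cyA K r)).card : ℝ)⁻¹ else 0)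
  have hE : ∀ r ∈ s, (0 : ℝ) < (cyE (cyI K) (cyA K r)).card := fun r hr => by
    have := Finset.card_pos.2 (cyE_nonempty K r (by simp [s] at hr; lia))
    exact_mod_cast this
  have hsum : ∀ (T : Finset (cyI K)) (c : cyI K → (cyI K × Bool) × (cyI K × Bool)),
      ∑ e with (∀ t ∈ T, e (t, false) = (c t).1 ∧ e (t, true) = (c t).2), μ e =
      ∑ r ∈ s, lam r * (((cyM (cyA K r) T c).card : ℝ) / (cyE (cyI K) (cyA K r)).card) := by
    intro T c
    simp only [μ]
    rw [Finset.sum_comm]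
    refine Finset.sum_congr rfl fun r _ => ?_
    rw [← Finset.mul_sum]
    congr 1
    rw [← Finset.sum_filter, Finset.sum_const, nsmul_eq_mul, div_eq_mul_inv]
    congr 3
    ext e
    simp only [cyM, Finset.mem_filter, Finset.mem_univ, true_and]
    tauto
  have hmain : ∀ (T : Finset (cyI K)) (c : cyI K → (cyI K × Bool) × (cyI K × Bool)), ∀ q : Polynomial ℝ,
      q.natDegree ≤ K → 
      (∀ r ≤ K, ((cyM (cyA K r) T c).card : ℝ) = q.eval (r : ℝ) * (cyE (cyI K) (cyA K r)).card) →
      ∑ e with (∀ t ∈ T, e (t, false) = (c t).1 ∧ e (t, true) = (c t).2), μ e = q.eval x := by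
    intro T c q hq h
    rw [hsum, ← hlam q hq]
    refine Finset.sum_congr rfl fun r hr => ?_
    rw [h r (by simp [s] at hr; lia), mul_div_cancel_right₀ _ (hE r hr).ne']
  refine ⟨μ, ?_, ?_⟩
  · have := hmain ∅ (fun t => ((t, false), (t, true))) 1 (by simp) (fun r hr => by simp [cyM])
    simpa using this
  · intro T c hT
    obtain ⟨q, h1, h2, h3, h4⟩ := cy_poly K c T hT
    rw [hmain T c q (h1.trans hT) h2]
    exact ⟨h3, h4⟩


theorem cy_pseudo (K : ℕ) (hK : 1 ≤ K) : ∃ μ : Perm (cyI K × Bool) → ℝ, ∑ e, μ e = 1 ∧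
    (∀ V : Finset (cyI K × Bool), V.card ≤ K → ∀ h : Perm (cyI K × Bool) → ℝ, (∀ e, 0 ≤ h e) →
      (∀ u : Perm (cyI K × Bool), (∀ v ∈ V, u v = v) → ∀ e, h (u * e) = h e) →
      0 ≤ ∑ e, μ e * h e) ∧
    ∑ e, μ e * ((Finset.univ.filter
      (fun t : cyI K => (e (t, false)).2 ≠ (e (t, true)).2)).card : ℝ) = 0 := by
  obtain ⟨μ, h1, h2⟩ := cy_mu K
  refine ⟨μ, h1, ?_, ?_⟩
  · intro V hV h hh hinv
    let T : Perm (cyI K × Bool) → Finset (cyI K) := fun e => V.image (fun v => (e⁻¹ v).1)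
    have hTm : ∀ e v, v ∈ V → (e⁻¹ v).1 ∈ T e := fun e v hv => Finset.mem_image_of_mem _ hv
    let key : Perm (cyI K × Bool) → (cyI K → Option ((cyI K × Bool) × (cyI K × Bool))) :=
      fun e t => if t ∈ T e then some (e (t, false), e (t, true)) else none
    let _ : DecidableEq (cyI K → Option ((cyI K × Bool) × (cyI K × Bool))) := Classical.decEq _
    rw [← Finset.sum_fiberwise_of_maps_to (t := Finset.univ.image key) (g := key)
      (fun e _ => Finset.mem_image_of_mem _ (Finset.mem_univ e))]
    refine Finset.sum_nonneg fun j hj => ?_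
    obtain ⟨e0, -, rfl⟩ := Finset.mem_image.1 hj
    -- agreement on slots
    have hag : ∀ e : Perm (cyI K × Bool), (∀ t ∈ T e0, e (t, false) = e0 (t, false) ∧ e (t, true) = e0 (t, true)) →
        ∀ v ∈ V, e⁻¹ v = e0⁻¹ v := by
      intro e he v hv
      rw [Perm.inv_eq_iff_eq]
      have := he _ (hTm e0 v hv)
      have h3 : e (e0⁻¹ v) = e0 (e0⁻¹ v) := by
        rcases hb : (e0⁻¹ v) with ⟨t, b⟩
        rw [hb] at this
        cases b
        · exact this.1
        · exact this.2
      rw [h3]; simp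
    have hkey : ∀ e, key e = key e0 ↔
        ∀ t ∈ T e0, e (t, false) = e0 (t, false) ∧ e (t, true) = e0 (t, true) := by
      intro e
      constructor
      · intro hk t ht
        have := congrFun hk t
        simp only [key, if_pos ht] at this
        split_ifs at this
        simpa using this
      · intro he
        have hT : T e = T e0 := Finset.image_congr fun v hv => by
          rw [hag e he v hv]
        funext t
        simp only [key, hT]
        split_ifs with ht
        · rw [(he t ht).1, (he t ht).2]
        · rfl
    have hconst : ∀ e, key e = key e0 → h e = h e0 := by
      intro e he
      have he' := hag e ((hkey e).1 he)
      have := hinv (e * e0⁻¹) (fun v hv => by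
        rw [Perm.mul_apply, ← he' v hv]; simp) e0
      rw [← this]; simp
    rw [Finset.sum_congr rfl (g := fun e => μ e * h e0) (fun e he => by
      rw [hconst e (Finset.mem_filter.1 he).2]), ← Finset.sum_mul]
    refine mul_nonneg ?_ (hh e0)
    have := (h2 (T e0) (fun t => (e0 (t, false), e0 (t, true))) (Finset.card_image_le.trans hV)).1
    refine this.trans_eq (Finset.sum_congr ?_ fun _ _ => rfl)
    exact Finset.filter_congr fun e _ => (hkey e).symm
  · have e1 : ∀ e : Perm (cyI K × Bool), μ e * ((Finset.univ.filter
        (fun t : cyI K => (e (t, false)).2 ≠ (e (t, true)).2)).card : ℝ) =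
        ∑ t : cyI K, ∑ q : (cyI K × Bool) × (cyI K × Bool),
          if q.1.2 ≠ q.2.2 then (if e (t, false) = q.1 ∧ e (t, true) = q.2 then μ e else 0) else 0 := by
      intro e
      rw [Finset.card_filter]
      push_cast
      rw [Finset.mul_sum]
      refine Finset.sum_congr rfl fun t _ => ?_
      rw [Finset.sum_eq_single (e (t, false), e (t, true))]
      · simp
      · rintro q _ hq
        have : ¬ (e (t, false) = q.1 ∧ e (t, true) = q.2) := fun ⟨a, b⟩ => hq (by rw [a, b])
        simp [this]
      · simp
    simp_rw [e1]
    rw [Finset.sum_comm]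
    refine Finset.sum_eq_zero fun t _ => ?_
    rw [Finset.sum_comm]
    refine Finset.sum_eq_zero fun q _ => ?_
    by_cases hq : q.1.2 ≠ q.2.2
    · simp only [if_pos hq]
      rw [← Finset.sum_filter]
      have := (h2 {t} (fun _ => q) (by simpa using hK)).2 ⟨t, by simp, hq⟩
      simpa using this
    · simp [hq]


/-- The permutation of `Fin n` moving the pairs indexed by `W`. -/
noncomputable def cyRho {n : ℕ} {W : Type} (γ : W × Bool ↪ Fin n) (e : Perm W) : Perm (Fin n) :=
  Perm.viaEmbedding (Equiv.prodCongr e (Equiv.refl Bool)) γ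

theorem cyRho_apply {n : ℕ} {W : Type} (γ : W × Bool ↪ Fin n) (e : Perm W) (w : W) (z : Bool) :
    cyRho γ e (γ (w, z)) = γ (e w, z) := by
  unfold cyRho
  rw [Perm.viaEmbedding_apply]
  rfl

theorem cyRho_apply_not {n : ℕ} {W : Type} (γ : W × Bool ↪ Fin n) (e : Perm W) (x : Fin n)
    (hx : x ∉ Set.range γ) : cyRho γ e x = x := by
  unfold cyRho
  exact Perm.viaEmbedding_apply_of_notMem _ _ _ hx

theorem cyRho_mul {n : ℕ} {W : Type} (γ : W × Bool ↪ Fin n) (a b : Perm W) :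
    cyRho γ (a * b) = cyRho γ a * cyRho γ b := by
  ext x
  by_cases hx : x ∈ Set.range γ
  · obtain ⟨⟨w, z⟩, rfl⟩ := hx
    simp [cyRho_apply]
  · simp [cyRho_apply_not γ _ x hx]

theorem cyRho_one {n : ℕ} {W : Type} (γ : W × Bool ↪ Fin n) :
    cyRho γ (1 : Perm W) = 1 := by
  have h := cyRho_mul γ (1 : Perm W) 1
  rw [mul_one] at h
  exact left_eq_mul.mp h

theorem cyRho_inv {n : ℕ} {W : Type} (γ : W × Bool ↪ Fin n) (a : Perm W) :
    (cyRho γ a)⁻¹ = cyRho γ a⁻¹ := by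
  rw [inv_eq_iff_mul_eq_one, ← cyRho_mul, mul_inv_cancel, cyRho_one]

theorem cyRho_swap {n : ℕ} {W : Type} [DecidableEq W] (γ : W × Bool ↪ Fin n) (a b : W) :
    cyRho γ (swap a b) = swap (γ (a, true)) (γ (b, true)) * swap (γ (a, false)) (γ (b, false)) := by
  apply Equiv.ext
  intro x
  by_cases hx : x ∈ Set.range γ
  · obtain ⟨⟨w, z⟩, rfl⟩ := hx
    rw [cyRho_apply, Perm.mul_apply]
    have hi : ∀ p q, γ p = γ q ↔ p = q := fun p q => γ.injective.eq_iff
    simp only [Equiv.swap_apply_def, hi, Prod.mk.injEq]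
    cases z <;> by_cases h1 : w = a <;> by_cases h2 : w = b <;> simp [h1, h2, hi]
    all_goals grind
  · rw [cyRho_apply_not γ _ x hx, Perm.mul_apply]
    have hi : ∀ p, x ≠ γ p := fun p h => hx ⟨p, h.symm⟩
    simp [Equiv.swap_apply_def, hi]

theorem cyRho_mem {n : ℕ} {W : Type} [DecidableEq W] [Fintype W] (γ : W × Bool ↪ Fin n)
    (G : Subgroup (Perm (Fin n))) (V : Finset (Fin n))
    (hG : ∀ a b c : Fin n, a ∉ V → b ∉ V → c ∉ V → a ≠ b → a ≠ c → b ≠ c → cyTri a b c ∈ G) :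
    ∃ V' : Finset W, V'.card ≤ V.card ∧ ∀ u : Perm W, (∀ v ∈ V', u v = v) → cyRho γ u ∈ G := by
  classical
  refine ⟨(V.preimage γ γ.injective.injOn).image Prod.fst, ?_, ?_⟩
  · refine Finset.card_image_le.trans ?_
    rw [← Finset.card_map γ]
    apply Finset.card_le_card
    intro x
    simp only [Finset.mem_map, Finset.mem_preimage]
    rintro ⟨a, ha, rfl⟩
    exact ha
  · set V' := (V.preimage γ γ.injective.injOn).image Prod.fst with hV'
    have hmem : ∀ w, w ∉ V' → ∀ z, γ (w, z) ∉ V := by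
      intro w hw z hz
      exact hw (Finset.mem_image.mpr ⟨(w, z), by simpa using hz, rfl⟩)
    intro u hu
    have hnot : ∀ x, u x ∉ V' ↔ x ∉ V' := by
      intro x
      constructor
      · intro h hx
        rw [hu x hx] at h
        exact h hx
      · intro h hx
        have := hu _ hx
        have := u.injective this
        rw [this] at hx
        exact h hx
    have key : ∀ s : Perm {w // w ∉ V'}, cyRho γ (Perm.ofSubtype s) ∈ G := by
      intro s
      induction s using Perm.swap_induction_on with
      | one => rw [map_one, cyRho_one]; exact G.one_mem
      | swap_mul f x y hxy ih =>
        rw [map_mul, cyRho_mul]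
        refine G.mul_mem ?_ ih
        rw [Perm.ofSubtype_swap_eq, cyRho_swap]
        have hne : (x : W) ≠ y := fun h => hxy (Subtype.ext h)
        have hi : ∀ p q, γ p = γ q ↔ p = q := fun p q => γ.injective.eq_iff
        have h4 : swap (γ (x.1, true)) (γ (y.1, true)) * swap (γ (x.1, false)) (γ (y.1, false))
          = cyTri (γ (x.1, true)) (γ (y.1, true)) (γ (x.1, false))
            * cyTri (γ (y.1, true)) (γ (x.1, false)) (γ (y.1, false)) := by
          unfold cyTri
          have := Equiv.swap_mul_self (γ (y.1, true)) (γ (x.1, false))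
          rw [mul_assoc, ← mul_assoc (swap (γ (y.1, true)) (γ (x.1, false))), this, one_mul]
        rw [h4]
        refine G.mul_mem (hG _ _ _ ?_ ?_ ?_ ?_ ?_ ?_) (hG _ _ _ ?_ ?_ ?_ ?_ ?_ ?_)
        all_goals first
          | exact hmem _ x.2 _
          | exact hmem _ y.2 _
          | simp [hi, hne, hne.symm]
    have := key (u.subtypePerm hnot)
    rwa [Perm.ofSubtype_subtypePerm] at this
    intro x hx hxV
    exact hx (hu x hxV)

theorem cy_act_one {n : ℕ} (x : Edge n → ℝ) : edgeAction 1 x = x := by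
  funext e
  unfold edgeAction edgeMap
  congr 1
  apply Subtype.ext
  simp

theorem cy_act_mul {n : ℕ} (a b : Perm (Fin n)) (x : Edge n → ℝ) :
    edgeAction (a * b) x = edgeAction a (edgeAction b x) := by
  funext e
  unfold edgeAction edgeMap
  congr 1
  apply Subtype.ext
  simp [Sym2.map_map, mul_inv_rev]

/-- The value of an edge vector at the pair `u, v` (zero on the diagonal). -/
noncomputable def cyEv {n : ℕ} (x : Edge n → ℝ) (u v : Fin n) : ℝ :=
  if h : u ≠ v then x ⟨s(u, v), by simpa using h⟩ else 0

theorem cyEv_add {n : ℕ} (x y : Edge n → ℝ) (u v : Fin n) :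
    cyEv (x + y) u v = cyEv x u v + cyEv y u v := by
  unfold cyEv; split_ifs <;> simp

theorem cyEv_smul {n : ℕ} (r : ℝ) (x : Edge n → ℝ) (u v : Fin n) :
    cyEv (r • x) u v = r * cyEv x u v := by
  unfold cyEv; split_ifs <;> simp

theorem cyEv_act {n : ℕ} (π : Perm (Fin n)) (x : Edge n → ℝ) (u v : Fin n) :
    cyEv (edgeAction π x) u v = cyEv x (π⁻¹ u) (π⁻¹ v) := by
  unfold cyEv
  by_cases h : u = v
  · simp [h]
  · have h' : π⁻¹ u ≠ π⁻¹ v := fun h2 => h (π⁻¹.injective h2)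
    rw [dif_pos h, dif_pos h']
    unfold edgeAction edgeMap
    congr 1

/-- Adjacency in a cycle. -/
def cyAdj {n ℓ : ℕ} (f : Fin ℓ → Fin n) (u v : Fin n) : Prop :=
  u ≠ v ∧ ∃ i : Fin ℓ, s(f i, f (finRotate ℓ i)) = s(u, v)

open Classical in
theorem cyEv_cycle {n ℓ : ℕ} (f : Fin ℓ → Fin n) (u v : Fin n) :
    cyEv (cycleVec f) u v = if cyAdj f u v then 1 else 0 := by
  unfold cyEv cycleVec cyAdj
  by_cases h : u = v
  · simp [h]
  · simp [h]

theorem cyAdj_symm {n ℓ : ℕ} (f : Fin ℓ → Fin n) (u v : Fin n) :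
    cyAdj f u v ↔ cyAdj f v u := by
  unfold cyAdj
  rw [Sym2.eq_swap (a := u), ne_comm]

open Classical in
theorem cyAdj_deg {n ℓ : ℕ} (f : Fin ℓ → Fin n) (hf : Function.Injective f) (u : Fin n) :
    (Finset.univ.filter (fun v => cyAdj f u v)).card ≤ 2 := by
  by_cases h : ∃ i, f i = u
  · obtain ⟨i, rfl⟩ := h
    refine (Finset.card_le_card (t := {f (finRotate ℓ i), f ((finRotate ℓ).symm i)}) ?_).trans
      Finset.card_le_two
    intro v hv
    simp only [Finset.mem_filter, Finset.mem_univ, true_and] at hv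
    obtain ⟨_, j, hj⟩ := hv
    rw [Sym2.eq_iff] at hj
    rcases hj with ⟨h1, h2⟩ | ⟨h1, h2⟩
    · rw [hf h1] at h2
      simp [← h2]
    · have h3 := hf h2
      have h4 : (finRotate ℓ).symm i = j := by rw [← h3, Equiv.symm_apply_apply]
      rw [h4, Finset.mem_insert, Finset.mem_singleton]
      exact Or.inr h1.symm
  · rw [Finset.card_eq_zero.mpr]
    · omega
    · rw [Finset.filter_eq_empty_iff]
      rintro v - ⟨_, j, hj⟩
      rw [Sym2.eq_iff] at hj
      rcases hj with ⟨h1, h2⟩ | ⟨h1, h2⟩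
      · exact h ⟨_, h1⟩
      · exact h ⟨_, h2⟩

theorem cy_even {T : Type} (s : Finset T) (b : T → T → ℕ) (hs : ∀ t t', b t t' = b t' t)
    (hd : ∀ t, b t t = 0) : Even (∑ t ∈ s, ∑ t' ∈ s, b t t') := by
  classical
  induction s using Finset.induction_on with
  | empty => simp
  | insert a s ha ih =>
    rw [Finset.sum_insert ha, Finset.sum_insert ha]
    have : ∑ t ∈ s, ∑ t' ∈ insert a s, b t t' = ∑ t ∈ s, b a t + ∑ t ∈ s, ∑ t' ∈ s, b t t' := by
      rw [← Finset.sum_add_distrib]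
      apply Finset.sum_congr rfl
      intro t _
      rw [Finset.sum_insert ha, hs]
    rw [this, hd, zero_add, ← add_assoc]
    exact (Even.add_self _).add ih

theorem cy_parity {T : Type} [Fintype T] (a : T → ℕ) (b : T → T → ℕ) (hs : ∀ t t', b t t' = b t' t)
    (hd : ∀ t, b t t = 0) (ha : ∀ t, a t ≤ 1) (hab : ∀ t, a t + ∑ t', b t t' ≤ 2)
    (hodd : Odd (Fintype.card T)) :
    2 * ∑ t, a t + ∑ t, ∑ t', b t t' + 1 ≤ 3 * Fintype.card T := by
  have h1 : ∑ t, a t ≤ Fintype.card T := by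
    refine (Finset.sum_le_sum (fun t _ => ha t)).trans ?_
    simp
  have h2 : ∑ t, a t + ∑ t, ∑ t', b t t' ≤ 2 * Fintype.card T := by
    rw [← Finset.sum_add_distrib]
    refine (Finset.sum_le_sum (fun t _ => hab t)).trans ?_
    simp [mul_comm]
  have h3 := cy_even Finset.univ b hs hd
  obtain ⟨r, hr⟩ := h3
  obtain ⟨q, hq⟩ := hodd
  omega

/-- The linear functional separating the pseudo-vertex. -/
noncomputable def cyPsi {n : ℕ} {T : Type} [Fintype T] (γ : (T × Bool) × Bool ↪ Fin n)
    (x : Edge n → ℝ) : ℝ :=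
  2 * ∑ t : T, cyEv x (γ ((t, false), true)) (γ ((t, false), false)) +
    ∑ t : T, ∑ t' : T, cyEv x (γ ((t, false), true)) (γ ((t', false), true))

theorem cyPsi_linear {n : ℕ} {T : Type} [Fintype T] (γ : (T × Bool) × Bool ↪ Fin n) :
    ∃ L : (Edge n → ℝ) →ₗ[ℝ] ℝ, ∀ x, L x = cyPsi γ x := by
  refine ⟨⟨⟨cyPsi γ, ?_⟩, ?_⟩, fun x => rfl⟩
  · intro x y
    unfold cyPsi
    simp only [cyEv_add, Finset.sum_add_distrib]
    ring
  · intro r x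
    unfold cyPsi
    simp only [cyEv_smul, ← Finset.mul_sum, RingHom.id_apply, smul_eq_mul]
    ring

theorem cyPsi_cycle {n ℓ : ℕ} {T : Type} [Fintype T] (γ : (T × Bool) × Bool ↪ Fin n)
    (hodd : Odd (Fintype.card T)) (f : Fin ℓ → Fin n) (hf : Function.Injective f) :
    cyPsi γ (cycleVec f) ≤ 3 * (Fintype.card T : ℝ) - 1 := by
  classical
  have hi : ∀ p q, γ p = γ q ↔ p = q := fun p q => γ.injective.eq_iff
  have h := cy_parity (T := T)
    (fun t => if cyAdj f (γ ((t, false), true)) (γ ((t, false), false)) then 1 else 0)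
    (fun t t' => if cyAdj f (γ ((t, false), true)) (γ ((t', false), true)) then 1 else 0)
    (fun t t' => by simp only [cyAdj_symm f (γ ((t, false), true))])
    (fun t => by simp [cyAdj])
    (fun t => by split_ifs <;> simp)
    (fun t => by
      refine le_trans ?_ (cyAdj_deg f hf (γ ((t, false), true)))
      rw [← Finset.card_filter]
      have : (if cyAdj f (γ ((t, false), true)) (γ ((t, false), false)) then 1 else 0)
        = (({γ ((t, false), false)} : Finset (Fin n)).filter
            (fun v => cyAdj f (γ ((t, false), true)) v)).card := by
        rw [Finset.card_filter, Finset.sum_singleton]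
      rw [this]
      have h2 : (Finset.univ.filter
          (fun t' => cyAdj f (γ ((t, false), true)) (γ ((t', false), true)))).card
        = ((Finset.univ.filter
          (fun t' => cyAdj f (γ ((t, false), true)) (γ ((t', false), true)))).image
            (fun t' => γ ((t', false), true))).card := by
        rw [Finset.card_image_of_injective]
        intro x y hxy
        simpa [hi] using hxy
      rw [h2, ← Finset.card_union_of_disjoint]
      · apply Finset.card_le_card
        intro v hv
        simp only [Finset.mem_union, Finset.mem_filter, Finset.mem_singleton, Finset.mem_image,
          Finset.mem_univ, true_and] at hv ⊢
        rcases hv with ⟨_, h⟩ | ⟨t', h, rfl⟩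
        · exact h
        · exact h
      · rw [Finset.disjoint_left]
        intro v hv hv'
        simp only [Finset.mem_filter, Finset.mem_singleton, Finset.mem_image,
          Finset.mem_univ, true_and] at hv hv'
        obtain ⟨t', _, h⟩ := hv'
        rw [hv.1, hi] at h
        simp at h)
    hodd
  unfold cyPsi
  simp only [cyEv_cycle]
  have h' : ((2 * ∑ t : T, (if cyAdj f (γ ((t, false), true)) (γ ((t, false), false)) then 1 else 0)
    + ∑ t : T, ∑ t' : T, (if cyAdj f (γ ((t, false), true)) (γ ((t', false), true)) then 1 else 0)
      + 1 : ℕ) : ℝ) ≤ ((3 * Fintype.card T : ℕ) : ℝ) := by exact_mod_cast h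
  push_cast at h'
  linarith

theorem cyPsi_polytope {n ℓ : ℕ} {T : Type} [Fintype T] (γ : (T × Bool) × Bool ↪ Fin n)
    (hodd : Odd (Fintype.card T)) (x : Edge n → ℝ) (hx : x ∈ cyclePolytope n ℓ) :
    cyPsi γ x ≤ 3 * (Fintype.card T : ℝ) - 1 := by
  obtain ⟨L, hL⟩ := cyPsi_linear γ
  have : cyclePolytope n ℓ ⊆ {x | L x ≤ 3 * (Fintype.card T : ℝ) - 1} := by
    apply convexHull_min
    · rintro _ ⟨f, hf, rfl⟩
      simp only [Set.mem_ofPred_eq, hL]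
      exact cyPsi_cycle γ hodd f hf
    · exact convex_halfSpace_le L.isLinear _
  have := this hx
  simpa [hL] using this


theorem cyAdj_base {n ℓ : ℕ} (h : ℓ ≤ n) (u v : Fin n) :
    cyAdj (Fin.castLE h : Fin ℓ → Fin n) u v ↔
      u ≠ v ∧ u.1 < ℓ ∧ v.1 < ℓ ∧ (v.1 = u.1 + 1 ∨ u.1 = v.1 + 1 ∨
        (u.1 + 1 = ℓ ∧ v.1 = 0) ∨ (v.1 + 1 = ℓ ∧ u.1 = 0)) := by
  unfold cyAdj
  apply and_congr_right
  intro huv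
  cases ℓ with
  | zero => simp
  | succ l =>
    constructor
    · rintro ⟨i, hi⟩
      have hr : ((finRotate (l + 1) i : Fin (l + 1)) : ℕ) =
        if i = Fin.last l then 0 else i.1 + 1 := coe_finRotate i
      rw [Sym2.eq_iff] at hi
      simp only [Fin.ext_iff, Fin.val_castLE, Fin.val_last] at hi hr
      have h1 := i.2
      split_ifs at hr <;> omega
    · rintro ⟨hu, hv, hh⟩
      have key : ∀ a b : Fin n, a.1 < l + 1 → b.1 < l + 1 →
        (b.1 = a.1 + 1 ∨ (a.1 + 1 = l + 1 ∧ b.1 = 0)) →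
        ∃ i : Fin (l + 1), (Fin.castLE h i) = a ∧ Fin.castLE h (finRotate (l + 1) i) = b := by
        intro a b ha hb hab
        refine ⟨⟨a.1, ha⟩, rfl, ?_⟩
        have hr : ((finRotate (l + 1) ⟨a.1, ha⟩ : Fin (l + 1)) : ℕ) =
          if (⟨a.1, ha⟩ : Fin (l + 1)) = Fin.last l then 0 else a.1 + 1 := coe_finRotate _
        simp only [Fin.ext_iff, Fin.val_castLE, Fin.val_last] at hr ⊢
        split_ifs at hr <;> omega
      have hh' : (v.1 = u.1 + 1 ∨ (u.1 + 1 = l + 1 ∧ v.1 = 0)) ∨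
        (u.1 = v.1 + 1 ∨ (v.1 + 1 = l + 1 ∧ u.1 = 0)) := by tauto
      rcases hh' with hh | hh
      · obtain ⟨i, h1, h2⟩ := key u v hu hv hh
        exact ⟨i, by rw [h1, h2]⟩
      · obtain ⟨i, h1, h2⟩ := key v u hv hu hh
        exact ⟨i, by rw [h1, h2, Sym2.eq_swap]⟩

/-- Position of a gadget node on the base cycle. -/
def cyPos {m : ℕ} {T : Type} (idx : T ≃ Fin m) (x : (T × Bool) × Bool) : ℕ :=
  4 * (idx x.1.1).1 + (if x.1.2 then (if x.2 then 2 else 3) else (if x.2 then 1 else 0))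

theorem cyPos_lt {m : ℕ} {T : Type} (idx : T ≃ Fin m) (x : (T × Bool) × Bool) :
    cyPos idx x < 4 * m := by
  unfold cyPos
  have := (idx x.1.1).2
  split_ifs <;> omega

theorem cyPos_inj {m : ℕ} {T : Type} (idx : T ≃ Fin m) : Function.Injective (cyPos idx) := by
  rintro ⟨⟨t, s⟩, z⟩ ⟨⟨t', s'⟩, z'⟩ h
  unfold cyPos at h
  have h1 : (idx t).1 = (idx t').1 := by
    dsimp only at h
    split_ifs at h <;> omega
  have h2 : t = t' := idx.injective (Fin.ext h1)
  subst h2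
  revert h
  cases s <;> cases s' <;> cases z <;> cases z' <;> simp

/-- The embedding of the gadget nodes. -/
def cyNode {m n : ℕ} {T : Type} (idx : T ≃ Fin m) (h : 4 * m ≤ n) : (T × Bool) × Bool ↪ Fin n :=
  ⟨fun x => ⟨cyPos idx x, (cyPos_lt idx x).trans_le h⟩, fun x y hxy =>
    cyPos_inj idx (by simpa using hxy)⟩

theorem cyNode_twin {m n ℓ : ℕ} {T : Type} (idx : T ≃ Fin m) (h : 4 * m ≤ n) (hl : ℓ ≤ n)
    (hm : 4 * m ≤ ℓ) (w : T × Bool) :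
    cyAdj (Fin.castLE hl : Fin ℓ → Fin n) (cyNode idx h (w, true)) (cyNode idx h (w, false)) := by
  rw [cyAdj_base]
  have h1 := cyPos_lt idx (w, true)
  have h2 := cyPos_lt idx (w, false)
  refine ⟨fun hh => ?_, ?_⟩
  · simpa using (cyNode idx h).injective hh
  · change cyPos idx (w, true) < ℓ ∧ cyPos idx (w, false) < ℓ ∧ _
    refine ⟨by omega, by omega, ?_⟩
    change cyPos idx (w, false) = cyPos idx (w, true) + 1 ∨
      cyPos idx (w, true) = cyPos idx (w, false) + 1 ∨ _
    obtain ⟨t, s⟩ := w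
    cases s
    · right; left; simp [cyPos]
    · left; simp [cyPos]

theorem cyNode_inner {m n ℓ : ℕ} {T : Type} (idx : T ≃ Fin m) (h : 4 * m ≤ n) (hl : ℓ ≤ n)
    (hm : 4 * m ≤ ℓ) (w w' : T × Bool) :
    cyAdj (Fin.castLE hl : Fin ℓ → Fin n) (cyNode idx h (w, true)) (cyNode idx h (w', true)) ↔
      w.1 = w'.1 ∧ w.2 ≠ w'.2 := by
  rw [cyAdj_base]
  have h1 := cyPos_lt idx (w, true)
  have h2 := cyPos_lt idx (w', true)
  have e1 : (cyNode idx h (w, true)).1 = cyPos idx (w, true) := rfl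
  have e2 : (cyNode idx h (w', true)).1 = cyPos idx (w', true) := rfl
  have e3 : w.1 = w'.1 ↔ (idx w.1).1 = (idx w'.1).1 := by
    rw [← Fin.ext_iff, idx.injective.eq_iff]
  rw [Ne, Fin.ext_iff, e1, e2, e3]
  obtain ⟨t, s⟩ := w
  obtain ⟨t', s'⟩ := w'
  cases s <;> cases s' <;> simp [cyPos] at h1 h2 ⊢ <;> omega

theorem cy_sum_false {T : Type} [Fintype T] (F : T × Bool → ℝ) :
    ∑ t, F (t, false) = ∑ w, if w.2 = false then F w else 0 := by
  rw [Fintype.sum_prod_type]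
  simp

open Classical in
theorem cyPsi_exact {m n ℓ : ℕ} {T : Type} [Fintype T] (idx : T ≃ Fin m) (h : 4 * m ≤ n)
    (hl : ℓ ≤ n) (hm : 4 * m ≤ ℓ) (e : Perm (T × Bool)) :
    cyPsi (cyNode idx h) (edgeAction (cyRho (cyNode idx h) e)
      (cycleVec (Fin.castLE hl : Fin ℓ → Fin n))) =
    3 * (Fintype.card T : ℝ) -
      ((Finset.univ.filter (fun t : T => (e (t, false)).2 ≠ (e (t, true)).2)).card : ℝ) := by
  unfold cyPsi
  simp only [cyEv_act, cyRho_inv, cyRho_apply, cyEv_cycle, cyNode_inner idx h hl hm,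
    cyNode_twin idx h hl hm, if_true]
  have hS : ∑ t : T, ∑ t' : T, (if (e⁻¹ (t, false)).1 = (e⁻¹ (t', false)).1 ∧
      (e⁻¹ (t, false)).2 ≠ (e⁻¹ (t', false)).2 then (1 : ℝ) else 0) =
      ∑ t : T, 2 * ((if (e (t, false)).2 = false then (1 : ℝ) else 0) *
        (if (e (t, true)).2 = false then (1 : ℝ) else 0)) := by
    rw [cy_sum_false (fun w => ∑ t' : T, (if (e⁻¹ w).1 = (e⁻¹ (t', false)).1 ∧
      (e⁻¹ w).2 ≠ (e⁻¹ (t', false)).2 then (1 : ℝ) else 0))]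
    rw [← Equiv.sum_comp e]
    have : ∀ s : T × Bool, ∑ t' : T, (if (e⁻¹ (e s)).1 = (e⁻¹ (t', false)).1 ∧
      (e⁻¹ (e s)).2 ≠ (e⁻¹ (t', false)).2 then (1 : ℝ) else 0) =
        if (e (s.1, !s.2)).2 = false then 1 else 0 := by
      intro s
      rw [cy_sum_false (fun w => (if (e⁻¹ (e s)).1 = (e⁻¹ w).1 ∧
      (e⁻¹ (e s)).2 ≠ (e⁻¹ w).2 then (1 : ℝ) else 0)), ← Equiv.sum_comp e]
      rw [Finset.sum_eq_single (s.1, !s.2)]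
      · simp
      · rintro ⟨a, b⟩ - hb
        have hs1 : e⁻¹ (e s) = s := by simp
        have hs2 : e⁻¹ (e (a, b)) = (a, b) := by simp
        rw [hs1, hs2]
        rw [if_neg (c := s.1 = a ∧ s.2 ≠ b)]
        · simp
        · rintro ⟨rfl, h2⟩
          apply hb
          revert h2
          cases b <;> cases s.2 <;> simp
      · simp
    simp only [this]
    rw [Fintype.sum_prod_type]
    apply Finset.sum_congr rfl
    intro t _
    simp only [Fintype.sum_bool, Bool.not_true, Bool.not_false]
    split_ifs <;> norm_num
  rw [hS]
  have hc : ∑ t : T, ((if (e (t, false)).2 = false then (1 : ℝ) else 0) +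
        (if (e (t, true)).2 = false then (1 : ℝ) else 0)) = Fintype.card T := by
    have h1 := cy_sum_false (T := T) (fun _ => (1 : ℝ))
    rw [← Equiv.sum_comp e, Fintype.sum_prod_type] at h1
    simp only [Fintype.sum_bool] at h1
    simp only [add_comm] at h1 ⊢
    rw [← h1]
    simp
  have hmix : ((Finset.univ.filter (fun t : T => (e (t, false)).2 ≠ (e (t, true)).2)).card : ℝ)
      = ∑ t : T, (((if (e (t, false)).2 = false then (1 : ℝ) else 0) +
        (if (e (t, true)).2 = false then (1 : ℝ) else 0)) -
        2 * ((if (e (t, false)).2 = false then (1 : ℝ) else 0) *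
        (if (e (t, true)).2 = false then (1 : ℝ) else 0))) := by
    rw [Finset.card_filter]
    push_cast
    apply Finset.sum_congr rfl
    intro t _
    cases (e (t, false)).2 <;> cases (e (t, true)).2 <;> norm_num
  rw [hmix, Finset.sum_sub_distrib, hc]
  simp only [Finset.sum_const, Finset.card_univ, nsmul_eq_mul, mul_one]
  ring


theorem cy_toDesc {d g f : ℕ} (Aeq : Fin g → Fin d → ℝ) (beq : Fin g → ℝ)
    (A : Fin f → Fin d → ℝ) (b : Fin f → ℝ) :
    cyDesc {y : Fin d → ℝ | (∀ i : Fin g, ∑ j, Aeq i j * y j = beq i) ∧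
              (∀ i : Fin f, ∑ j, A i j * y j ≤ b i)} f := by
  have hex : ∀ (a : Fin d → ℝ) (r : ℝ), ∃ φ : (Fin d → ℝ) →ᵃ[ℝ] ℝ,
      ∀ y, φ y = r - ∑ j, a j * y j := by
    intro a r
    refine ⟨AffineMap.const ℝ _ r - (∑ j, a j • LinearMap.proj (R := ℝ) (φ := fun _ : Fin d => ℝ) j
      : (Fin d → ℝ) →ₗ[ℝ] ℝ).toAffineMap, ?_⟩
    intro y
    simp
  choose F hF using hex
  refine ⟨Set.range (fun i => F (Aeq i) (beq i)), fun i => F (A i) (b i), ?_⟩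
  ext y
  simp only [Set.mem_ofPred_eq, Set.forall_mem_range, hF, sub_nonneg, sub_eq_zero]
  constructor
  · rintro ⟨h1, h2⟩
    exact ⟨fun i => (h1 i).symm, h2⟩
  · rintro ⟨h1, h2⟩
    exact ⟨fun i => (h1 i).symm, h2⟩

theorem cy_core (k n ℓ d f : ℕ) (hl : ℓ ≤ n) (hm : 4 * (2 * (k + 1) + 1) ≤ ℓ)
    (hgr : ∀ (I : Type) [Fintype I] (G : Subgroup (Perm (Fin n))) (col : Perm (Fin n) → I),
      (∀ g g', col g = col g' → g⁻¹ * g' ∈ G) → Fintype.card I ≤ n ^ k →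
      ∃ V : Finset (Fin n), V.card ≤ k ∧ ∀ a b c : Fin n, a ∉ V → b ∉ V → c ∉ V →
        a ≠ b → a ≠ c → b ≠ c → cyTri a b c ∈ G)
    (Q : Set (Fin d → ℝ)) (hQ : cyDesc Q f)
    (p : (Fin d → ℝ) →ᵃ[ℝ] (Edge n → ℝ)) (hp : p '' Q = cyclePolytope n ℓ)
    (hsym : ∀ π : Equiv.Perm (Fin n),
              ∃ (U : Matrix (Fin d) (Fin d) ℝ) (u : Fin d → ℝ),
                U * U.transpose = 1 ∧
                (fun y : Fin d → ℝ => U.mulVec y + u) '' Q = Q ∧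
                ∀ y ∈ Q, p (U.mulVec y + u) = edgeAction π (p y))
    (hf : f ≤ n ^ k) : False := by
  classical
  have hx0 : cycleVec (Fin.castLE hl : Fin ℓ → Fin n) ∈ cyclePolytope n ℓ :=
    subset_convexHull ℝ _ ⟨_, Fin.castLE_injective hl, rfl⟩
  rw [← hp] at hx0
  obtain ⟨y0, hy0, hpy0⟩ := hx0
  obtain ⟨f', hf', Φ, σ, hQe, hκ⟩ := cy_sym Q ⟨y0, hy0⟩ hQ
  have hmem : ∀ y, y ∈ Q ↔ (∀ φ ∈ Φ, φ y = 0) ∧ ∀ i, 0 ≤ σ i y := by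
    intro y
    constructor
    · intro hy
      rw [hQe] at hy
      exact hy
    · intro hy
      rw [hQe]
      exact hy
  have hS : ∀ π : Perm (Fin n), ∃ (κ : (Fin d → ℝ) → (Fin d → ℝ)) (τ : Perm (Fin f')),
      (∀ y ∈ Q, κ y ∈ Q) ∧ (∀ y ∈ Q, p (κ y) = edgeAction π (p y)) ∧
        ∀ i, ∀ y ∈ Q, σ i (κ y) = σ (τ i) y := by
    intro π
    obtain ⟨U, u, hU, him, hpp⟩ := hsym π
    obtain ⟨κ, hκ1, hκ2⟩ := cy_matrix U u hU
    have hiff : ∀ y, κ y ∈ Q ↔ y ∈ Q := by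
      intro y
      constructor
      · intro hy
        rw [← him] at hy
        obtain ⟨z, hz, hzy⟩ := hy
        have : κ z = κ y := by rw [hκ1 z]; exact hzy
        rw [← κ.injective this]
        exact hz
      · intro hy
        rw [← him]
        exact ⟨y, hy, (hκ1 y).symm⟩
    obtain ⟨τ, hτ⟩ := hκ κ hiff hκ2
    refine ⟨κ, τ, fun y hy => (hiff y).2 hy, fun y hy => ?_, hτ⟩
    rw [hκ1 y]
    exact hpp y hy
  obtain ⟨Y, hYQ, hYp, hYG⟩ := cy_avg (H := Perm (Fin n)) (I := Fin f') Q
    (by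
      intro s w y hw hw1 hy
      rw [hmem]
      constructor
      · intro φ hφ
        rw [cy_affsum φ s w hw1 y]
        apply Finset.sum_eq_zero
        intro i hi
        rw [((hmem _).1 (hy i hi)).1 φ hφ, smul_zero]
      · intro i
        rw [cy_affsum (σ i) s w hw1 y]
        apply Finset.sum_nonneg
        intro j hj
        exact mul_nonneg (hw j hj) (((hmem _).1 (hy j hj)).2 i))
    p σ edgeAction cy_act_one cy_act_mul hS y0 hy0
  have hcard : Fintype.card (cyI (k + 1)) = 2 * (k + 1) + 1 := by
    simp [cyI, mul_comm]
  let idx : cyI (k + 1) ≃ Fin (2 * (k + 1) + 1) := Fintype.equivFinOfCardEq hcard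
  have hmn : 4 * (2 * (k + 1) + 1) ≤ n := hm.trans hl
  let γ := cyNode idx hmn
  obtain ⟨μ, hμ1, hμ2, hμ3⟩ := cy_pseudo (k + 1) (by omega)
  let yb := ∑ e, μ e • Y (cyRho γ e)
  have hyb : yb ∈ Q := by
    rw [hmem]
    constructor
    · intro φ hφ
      rw [cy_affsum φ _ μ hμ1]
      apply Finset.sum_eq_zero
      intro e _
      rw [((hmem _).1 (hYQ _)).1 φ hφ, smul_zero]
    · intro i
      rw [cy_affsum (σ i) _ μ hμ1]
      obtain ⟨G, col, hcol, hinv⟩ := hYG i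
      obtain ⟨V, hV, hVG⟩ := hgr (Fin f') G col hcol (by
        rw [Fintype.card_fin]; exact hf'.trans hf)
      obtain ⟨V', hV', hVr⟩ := cyRho_mem γ G V hVG
      refine hμ2 V' (by omega) (fun e => σ i (Y (cyRho γ e))) (fun e => ?_) ?_
      · exact ((hmem _).1 (hYQ _)).2 i
      · intro u hu e
        rw [cyRho_mul]
        exact hinv _ (hVr u hu) _
  have h1 : cyPsi γ (p yb) ≤ 3 * (Fintype.card (cyI (k + 1)) : ℝ) - 1 := by
    apply cyPsi_polytope (ℓ := ℓ) γ
    · rw [hcard]; exact ⟨k + 1, rfl⟩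
    · rw [← hp]; exact ⟨yb, hyb, rfl⟩
  have h2 : cyPsi γ (p yb) = 3 * (Fintype.card (cyI (k + 1)) : ℝ) := by
    obtain ⟨L, hL⟩ := cyPsi_linear γ
    rw [← hL, cy_affsum p _ μ hμ1, map_sum]
    have : ∀ e, L (μ e • p (Y (cyRho γ e))) = μ e * (3 * (Fintype.card (cyI (k + 1)) : ℝ)) -
        μ e * ((Finset.univ.filter (fun t : cyI (k + 1) =>
          (e (t, false)).2 ≠ (e (t, true)).2)).card : ℝ) := by
      intro e
      rw [map_smul, hYp, hpy0, hL, cyPsi_exact idx hmn hl hm e, smul_eq_mul, mul_sub]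
    rw [Finset.sum_congr rfl (fun e _ => this e), Finset.sum_sub_distrib, hμ3, ← Finset.sum_mul,
      hμ1]
    ring
  linarith

end

/-- Corollary 5.2.  For every constant `c > 0` and every `k` there is
`n₀` such that for all `n ≥ n₀` and every `ℓ` with `c·log₂ n ≤ ℓ ≤ n`, every
isometry-symmetric (w.r.t. `S_n`) extension of `P_cycl(ℓ,n)` — given as the solution
set of linear equations together with `f` linear inequalities — satisfies `f > n^k`.
In particular there is no symmetric extended formulation of size polynomial in `n`. -/
theorem statement16 (c : ℝ) (hc : 0 < c) (k : ℕ) :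
    ∃ n₀ : ℕ, ∀ n : ℕ, n₀ ≤ n →
      ∀ ℓ d g f : ℕ, c * Real.logb 2 (n : ℝ) ≤ (ℓ : ℝ) → ℓ ≤ n →
        ∀ (Aeq : Fin g → Fin d → ℝ) (beq : Fin g → ℝ)
          (A : Fin f → Fin d → ℝ) (b : Fin f → ℝ)
          (Q : Set (Fin d → ℝ)),
          Q = {y : Fin d → ℝ |
              (∀ i : Fin g, ∑ j, Aeq i j * y j = beq i) ∧
              (∀ i : Fin f, ∑ j, A i j * y j ≤ b i)} →
          ∀ p : (Fin d → ℝ) →ᵃ[ℝ] (Edge n → ℝ),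
            p '' Q = cyclePolytope n ℓ →
            (∀ π : Equiv.Perm (Fin n),
              ∃ (U : Matrix (Fin d) (Fin d) ℝ) (u : Fin d → ℝ),
                U * U.transpose = 1 ∧
                (fun y : Fin d → ℝ => U.mulVec y + u) '' Q = Q ∧
                ∀ y ∈ Q, p (U.mulVec y + u) = edgeAction π (p y)) →
            ((n : ℝ) ^ k < (f : ℝ)) := by
  obtain ⟨n0, hn0⟩ := cy_group k
  refine ⟨max n0 (max 1 (Nat.ceil ((2 : ℝ) ^ (((4 * (2 * (k + 1) + 1) : ℕ) : ℝ) / c)))), ?_⟩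
  intro n hn ℓ d g f hlog hl Aeq beq A b Q hQ p hp hsym
  have h1 : n0 ≤ n := le_trans (le_max_left _ _) hn
  have h2 := le_trans (le_max_right _ _) hn
  have h3 : 1 ≤ n := le_trans (le_max_left _ _) h2
  have h4 := Nat.ceil_le.mp (le_trans (le_max_right _ _) h2)
  have hm : 4 * (2 * (k + 1) + 1) ≤ ℓ := by
    have h5 : ((4 * (2 * (k + 1) + 1) : ℕ) : ℝ) / c ≤ Real.logb 2 n := by
      rw [Real.le_logb_iff_rpow_le (by norm_num) (by exact_mod_cast h3)]
      exact h4
    rw [div_le_iff₀ hc] at h5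
    have : ((4 * (2 * (k + 1) + 1) : ℕ) : ℝ) ≤ (ℓ : ℝ) := by linarith
    exact_mod_cast this
  by_contra hcon
  have hf : f ≤ n ^ k := by
    have := not_lt.mp hcon
    exact_mod_cast this
  refine cy_core k n ℓ d f hl hm (hn0 n h1) Q ?_ p hp hsym hf
  rw [hQ]
  exact cy_toDesc Aeq beq A b

end
end

section
/- There is a constant C > 0 such that for all integers n ≥ 2 and ℓ ≥ 3, the polytope P_cycl(ℓ,n) has an extension of size at most 2^{Cℓ} · n³ · log₂ n; that is, there exist d ∈ ℕ, a polyhedron Q ⊆ ℝ^d described by a system of linear equations together with at most 2^{Cℓ} · n³ · log₂ n linear inequalities, and an affine map p : ℝ^d → ℝ^{E_n} with p(Q) = P_cycl(ℓ,n). -/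
open scoped BigOperators
open Classical in
noncomputable section

/-! ### Homogenised convex hulls -/

/-- `(m, z)` lies in the cone over `{1} × conv X`. -/
def InK {V : Type*} [AddCommGroup V] [Module ℝ V] (X : Set V) (m : ℝ) (z : V) : Prop :=
  (m = 0 ∧ z = 0) ∨ (0 < m ∧ ∃ u ∈ convexHull ℝ X, z = m • u)

section Cone

variable {V : Type*} [AddCommGroup V] [Module ℝ V]

theorem InK.zero (X : Set V) : InK X 0 0 := Or.inl ⟨rfl, rfl⟩

theorem InK.add {X : Set V} {m m' : ℝ} {z z' : V} (h : InK X m z) (h' : InK X m' z') :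
    InK X (m + m') (z + z') := by
  rcases h with ⟨rfl, rfl⟩ | ⟨hm, u, hu, rfl⟩
  · simpa using h'
  · rcases h' with ⟨rfl, rfl⟩ | ⟨hm', u', hu', rfl⟩
    · exact Or.inr ⟨by simpa using hm, u, hu, by simp⟩
    · refine Or.inr ⟨by positivity, (m / (m + m')) • u + (m' / (m + m')) • u', ?_, ?_⟩
      · have hne : m + m' ≠ 0 := by positivity
        exact (convex_convexHull ℝ X) hu hu' (by positivity) (by positivity)
          (by rw [← add_div, div_self hne])
      · have hne : m + m' ≠ 0 := by positivity
        rw [smul_add, smul_smul, smul_smul, mul_div_cancel₀ _ hne, mul_div_cancel₀ _ hne]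

theorem InK.sum {ι : Type*} {X : Set V} (s : Finset ι) (m : ι → ℝ) (z : ι → V)
    (h : ∀ i ∈ s, InK X (m i) (z i)) : InK X (∑ i ∈ s, m i) (∑ i ∈ s, z i) := by
  classical
  induction s using Finset.induction_on with
  | empty => simpa using InK.zero X
  | insert a s ha ih =>
    rw [Finset.sum_insert ha, Finset.sum_insert ha]
    exact (h a (Finset.mem_insert_self _ _)).add
      (ih fun i hi => h i (Finset.mem_insert_of_mem hi))

theorem InK.smul {X : Set V} {m : ℝ} {z : V} (h : InK X m z) {c : ℝ} (hc : 0 < c) :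
    InK X (c * m) (c • z) := by
  rcases h with ⟨rfl, rfl⟩ | ⟨hm, u, hu, rfl⟩
  · simpa using InK.zero X
  · exact Or.inr ⟨by positivity, u, hu, by rw [smul_smul]⟩

theorem InK.shift {X Y : Set V} {m : ℝ} {z : V} (h : InK X m z) (w : V)
    (hw : ∀ x ∈ X, x + w ∈ Y) : InK Y m (z + m • w) := by
  rcases h with ⟨rfl, rfl⟩ | ⟨hm, u, hu, rfl⟩
  · simpa using InK.zero Y
  · refine Or.inr ⟨hm, u + w, ?_, by rw [smul_add]⟩
    have : convexHull ℝ X ⊆ (fun x => x + w) ⁻¹' convexHull ℝ Y := by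
      refine convexHull_min (fun x hx => subset_convexHull ℝ Y (hw x hx)) ?_
      have := (convex_convexHull ℝ Y).translate_preimage_left w
      exact this
    exact this hu

theorem InK.mono {X Y : Set V} {m : ℝ} {z : V} (h : InK X m z) (hXY : X ⊆ Y) : InK Y m z := by
  rcases h with h | ⟨hm, u, hu, rfl⟩
  · exact Or.inl h
  · exact Or.inr ⟨hm, u, convexHull_mono hXY hu, rfl⟩

end Cone

/-! ### Flows in layered networks -/

/-- The decomposition of a unit flow in a layered network into paths, in terms of the
vectors in `V` collected along the paths. -/
theorem flow_decomp {V A S : Type*} [AddCommGroup V] [Module ℝ V] [Fintype A] [Fintype S]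
    [DecidableEq S] (src tgt : A → S) (w : ℕ → A → V) (R : ℕ → S → Set V) (T : ℕ)
    (y : ℕ → A → ℝ)
    (hy : ∀ t ≤ T, ∀ a, 0 ≤ y t a)
    (hbase : ∀ a, y 0 a ≠ 0 → (0 : V) ∈ R 0 (src a))
    (hstep : ∀ t ≤ T, ∀ a, y t a ≠ 0 → ∀ x ∈ R t (src a), x + w t a ∈ R (t + 1) (tgt a))
    (hcons : ∀ t < T, ∀ s, ∑ a with tgt a = s, y t a = ∑ a with src a = s, y (t + 1) a)
    (htot : ∑ a, y 0 a = 1) (X : Set V) (hX : ∀ s, R (T + 1) s ⊆ X) :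
    ∑ t ∈ Finset.range (T + 1), ∑ a, y t a • w t a ∈ convexHull ℝ X := by
  have key : ∀ t ≤ T, ∑ a, y t a = 1 ∧ ∃ z : S → V,
      (∀ s, InK (R (t + 1) s) (∑ a with tgt a = s, y t a) (z s)) ∧
      ∑ s, z s = ∑ t' ∈ Finset.range (t + 1), ∑ a, y t' a • w t' a := by
    intro t
    induction t with
    | zero =>
      intro _
      refine ⟨htot, fun s => ∑ a with tgt a = s, y 0 a • w 0 a, fun s => ?_, ?_⟩
      · refine InK.sum _ _ _ fun a ha => ?_
        obtain rfl : tgt a = s := by simpa using ha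
        by_cases h0 : y 0 a = 0
        · rw [h0, zero_smul]; exact InK.zero _
        · refine Or.inr ⟨lt_of_le_of_ne (hy 0 (Nat.zero_le _) a) (Ne.symm h0), w 0 a, ?_, rfl⟩
          apply subset_convexHull
          simpa using hstep 0 (Nat.zero_le _) a h0 0 (hbase a h0)
      · rw [Finset.sum_fiberwise]; simp
    | succ t ih =>
      intro ht
      obtain ⟨h1, z, hz, hsum⟩ := ih (by omega)
      have hc := hcons t (by omega)
      set M : S → ℝ := fun s => ∑ a with tgt a = s, y t a with hM
      have hc' : ∀ s, ∑ a with src a = s, y (t + 1) a = M s := fun s => (hc s).symm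
      refine ⟨?_, fun s => ∑ a with tgt a = s,
        ((y (t + 1) a / M (src a)) • z (src a) + y (t + 1) a • w (t + 1) a), fun s => ?_, ?_⟩
      · rw [← h1, ← Finset.sum_fiberwise _ src, ← Finset.sum_fiberwise _ tgt]
        exact Finset.sum_congr rfl fun s _ => hc' s
      · refine InK.sum _ _ _ fun a ha => ?_
        obtain rfl : tgt a = s := by simpa using ha
        by_cases h0 : y (t + 1) a = 0
        · simp only [h0, zero_div, zero_smul, add_zero]; exact InK.zero _
        · have hpos : 0 < y (t + 1) a := lt_of_le_of_ne (hy _ ht a) (Ne.symm h0)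
          have hMpos : 0 < M (src a) := by
            rw [← hc']
            refine lt_of_lt_of_le hpos ?_
            exact Finset.single_le_sum (f := fun a => y (t + 1) a)
              (fun b _ => hy _ ht b) (by simp)
          have h2 := ((hz (src a)).smul (div_pos hpos hMpos)).shift (w (t + 1) a)
            (hstep (t + 1) ht a h0)
          have h3 : y (t + 1) a / M (src a) * (∑ b with tgt b = src a, y t b) = y (t + 1) a :=
            div_mul_cancel₀ _ hMpos.ne'
          rw [h3] at h2
          exact h2
      · rw [Finset.sum_fiberwise, Finset.sum_add_distrib, Finset.sum_range_succ _ (t + 1), ← hsum]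
        congr 1
        rw [← Finset.sum_fiberwise _ src]
        refine Finset.sum_congr rfl fun s _ => ?_
        have h4 : ∑ a with src a = s, (y (t + 1) a / M (src a)) • z (src a)
            = ∑ a with src a = s, (y (t + 1) a / M s) • z s := by
          refine Finset.sum_congr rfl fun a ha => ?_
          rw [(Finset.mem_filter.1 ha).2]
        rw [h4, ← Finset.sum_smul, ← Finset.sum_div, hc' s]
        rcases hz s with ⟨h5, h6⟩ | ⟨h5, -⟩
        · rw [h6, smul_zero]
        · have : M s ≠ 0 := h5.ne'
          rw [div_self this, one_smul]
  obtain ⟨h1, z, hz, hsum⟩ := key T le_rfl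
  have hfin := InK.sum Finset.univ _ _ fun s _ => (hz s).mono (hX s)
  rw [Finset.sum_fiberwise, h1, hsum] at hfin
  rcases hfin with ⟨h, -⟩ | ⟨-, u, hu, h⟩
  · norm_num at h
  · rw [h, one_smul]; exact hu

/-- Extended formulations given with arbitrary finite index types, linear equations, and
nonnegativity constraints can be brought to the form with index types `Fin`. -/
theorem ext_of_types {ι κ E : Type*} [Fintype ι] [Fintype κ]
    (L : κ → (ι → ℝ) →ₗ[ℝ] ℝ) (c : κ → ℝ) (p : (ι → ℝ) →ₗ[ℝ] (E → ℝ)) (P : Set (E → ℝ))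
    (h : p '' {y | (∀ k, L k y = c k) ∧ ∀ i, 0 ≤ y i} = P) :
    ∃ (d g : ℕ) (Aeq : Fin g → Fin d → ℝ) (beq : Fin g → ℝ)
      (A : Fin (Fintype.card ι) → Fin d → ℝ) (b : Fin (Fintype.card ι) → ℝ)
      (p : (Fin d → ℝ) →ᵃ[ℝ] (E → ℝ)),
      p '' {y : Fin d → ℝ |
        (∀ i : Fin g, ∑ j, Aeq i j * y j = beq i) ∧
        (∀ i : Fin (Fintype.card ι), ∑ j, A i j * y j ≤ b i)} = P := by
  classical
  let eι := Fintype.equivFin ι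
  let eκ := Fintype.equivFin κ
  let F : (Fin (Fintype.card ι) → ℝ) ≃ₗ[ℝ] (ι → ℝ) := LinearEquiv.funCongrLeft ℝ ℝ eι
  have hF : ∀ y i, F y i = y (eι i) := fun y i => rfl
  refine ⟨Fintype.card ι, Fintype.card κ,
    fun i j => L (eκ.symm i) (F fun j' => if j = j' then 1 else 0), fun i => c (eκ.symm i),
    fun i j => if i = j then -1 else 0, fun _ => 0, (p ∘ₗ F.toLinearMap).toAffineMap, ?_⟩
  have hset : {y : Fin (Fintype.card ι) → ℝ |
      (∀ i, ∑ j, L (eκ.symm i) (F fun j' => if j = j' then 1 else 0) * y j = c (eκ.symm i)) ∧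
      (∀ i : Fin (Fintype.card ι), ∑ j, (if i = j then (-1 : ℝ) else 0) * y j ≤ 0)}
      = F ⁻¹' {y | (∀ k, L k y = c k) ∧ ∀ i, 0 ≤ y i} := by
    ext y
    have hL : ∀ k, ∑ j, L k (F fun j' => if j = j' then 1 else 0) * y j = L k (F y) := by
      intro k
      have := LinearMap.pi_apply_eq_sum_univ (L k ∘ₗ F.toLinearMap) y
      simp only [LinearMap.comp_apply, LinearEquiv.coe_coe, smul_eq_mul] at this
      rw [this]
      exact Finset.sum_congr rfl fun j _ => mul_comm _ _
    simp only [Set.mem_ofPred_eq, Set.mem_preimage, hL]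
    refine and_congr ⟨fun h k => by simpa using h (eκ k), fun h i => h _⟩ ?_
    simp only [ite_mul, neg_mul, one_mul, zero_mul, Finset.sum_ite_eq, Finset.mem_univ, if_true,
      Left.neg_nonpos_iff]
    refine ⟨fun h i => h _, fun h i => by simpa [hF] using h (eι.symm i)⟩
  rw [hset, ← h]
  ext x
  constructor
  · rintro ⟨y, hy, rfl⟩
    exact ⟨F y, hy, rfl⟩
  · rintro ⟨y, hy, rfl⟩
    refine ⟨F.symm y, ?_, ?_⟩
    · simpa only [Set.mem_preimage, LinearEquiv.apply_symm_apply] using hy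
    · show p (F (F.symm y)) = _
      rw [LinearEquiv.apply_symm_apply]

/-- Extended formulation from a layered network. -/
theorem network_ext {E A S : Type} [Fintype A] [Fintype S]
    (src tgt : A → S) (w : ℕ → A → (E → ℝ)) (R : ℕ → S → Set (E → ℝ)) (T : ℕ)
    (al : ℕ → A → Prop) (X : Set (E → ℝ))
    (hbase : ∀ a, al 0 a → (0 : E → ℝ) ∈ R 0 (src a))
    (hstep : ∀ t ≤ T, ∀ a, al t a → ∀ x ∈ R t (src a), x + w t a ∈ R (t + 1) (tgt a))
    (hX : ∀ s, R (T + 1) s ⊆ X)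
    (hpath : ∀ x ∈ X, ∃ α : ℕ → A, (∀ t ≤ T, al t (α t)) ∧
      (∀ t < T, tgt (α t) = src (α (t + 1))) ∧ x = ∑ t ∈ Finset.range (T + 1), w t (α t)) :
    ∃ (d g f : ℕ) (Aeq : Fin g → Fin d → ℝ) (beq : Fin g → ℝ)
      (A' : Fin f → Fin d → ℝ) (b : Fin f → ℝ)
      (p : (Fin d → ℝ) →ᵃ[ℝ] (E → ℝ)), f = (T + 1) * Fintype.card A ∧
      p '' {y : Fin d → ℝ |
        (∀ i : Fin g, ∑ j, Aeq i j * y j = beq i) ∧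
        (∀ i : Fin f, ∑ j, A' i j * y j ≤ b i)} = convexHull ℝ X := by
  classical
  let ι := Fin (T + 1) × A
  let κ := (Fin (T + 1) × A) ⊕ (Fin T × S) ⊕ Unit
  let pr : ι → (ι → ℝ) →ₗ[ℝ] ℝ := fun i => LinearMap.proj i
  let L : κ → (ι → ℝ) →ₗ[ℝ] ℝ := fun k => match k with
    | .inl (t, a) => if al t a then 0 else pr (t, a)
    | .inr (.inl (t, s)) => (∑ a with tgt a = s, pr (t.castSucc, a))
        - ∑ a with src a = s, pr (t.succ, a)
    | .inr (.inr _) => ∑ a, pr (0, a)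
  let c : κ → ℝ := fun k => match k with
    | .inl _ => 0
    | .inr (.inl _) => 0
    | .inr (.inr _) => 1
  let p : (ι → ℝ) →ₗ[ℝ] (E → ℝ) := ∑ t : Fin (T + 1), ∑ a : A, (pr (t, a)).smulRight (w t a)
  have hp : ∀ y, p y = ∑ t : Fin (T + 1), ∑ a : A, y (t, a) • w t a := by
    intro y
    simp [p, pr, LinearMap.sum_apply]
  have hmem : ∀ y : ι → ℝ, (∀ k, L k y = c k) ↔
      (∀ t : Fin (T + 1), ∀ a, ¬ al t a → y (t, a) = 0) ∧
      (∀ (t : Fin T) s, ∑ a with tgt a = s, y (t.castSucc, a)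
        = ∑ a with src a = s, y (t.succ, a)) ∧ ∑ a, y (0, a) = 1 := by
    intro y
    constructor
    · intro h
      refine ⟨fun t a hta => ?_, fun t s => ?_, ?_⟩
      · simpa [L, c, pr, hta] using h (.inl (t, a))
      · simpa [L, c, pr, LinearMap.sum_apply, sub_eq_zero] using h (.inr (.inl (t, s)))
      · simpa [L, c, pr, LinearMap.sum_apply] using h (.inr (.inr ()))
    · rintro ⟨h1, h2, h3⟩ (⟨t, a⟩ | ⟨t, s⟩ | ⟨⟩)
      · by_cases hta : al t a
        · simp [L, c, hta]
        · simpa [L, c, pr, hta] using h1 t a hta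
      · simpa [L, c, pr, LinearMap.sum_apply, sub_eq_zero] using h2 t s
      · simpa [L, c, pr, LinearMap.sum_apply] using h3
  have main : p '' {y | (∀ k, L k y = c k) ∧ ∀ i, 0 ≤ y i} = convexHull ℝ X := by
    apply Set.Subset.antisymm
    · rintro _ ⟨y, ⟨hk, hpos⟩, rfl⟩
      obtain ⟨h1, h2, h3⟩ := (hmem y).1 hk
      let Y : ℕ → A → ℝ := fun t a => if h : t < T + 1 then y (⟨t, h⟩, a) else 0
      have hY : ∀ t (h : t < T + 1) a, Y t a = y (⟨t, h⟩, a) := fun t h a => dif_pos h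
      have hal : ∀ t ≤ T, ∀ a, Y t a ≠ 0 → al t a := by
        intro t ht a hne
        by_contra hcon
        apply hne
        rw [hY t (by omega)]
        exact h1 ⟨t, by omega⟩ a hcon
      have := flow_decomp src tgt w R T Y
        (fun t ht a => by rw [hY t (by omega)]; exact hpos _)
        (fun a ha => hbase a (hal 0 (Nat.zero_le _) a ha))
        (fun t ht a ha => hstep t ht a (hal t ht a ha))
        (fun t ht s => by
          have := h2 ⟨t, ht⟩ s
          simp only [hY t (by omega), hY (t + 1) (by omega)]
          exact this)
        (by simp only [hY 0 (by omega)]; exact h3) X hX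
      rw [hp]
      rw [Finset.sum_range] at this
      convert this using 4 with t _ a _
      rw [hY t t.2]
    · refine convexHull_min ?_ ?_
      · intro x hx
        obtain ⟨α, ha, hc, rfl⟩ := hpath x hx
        refine ⟨fun i => if i.2 = α i.1 then 1 else 0, ⟨(hmem _).2 ⟨?_, ?_, ?_⟩, ?_⟩, ?_⟩
        · intro t a hta
          have : a ≠ α t := by
            rintro rfl
            exact hta (ha t (by omega))
          simp [this]
        · intro t s
          have := hc t t.2
          simp [this]
        · show (∑ a, if a = α 0 then (1 : ℝ) else 0) = 1
          simp
        · intro i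
          dsimp only
          split_ifs <;> norm_num
        · rw [hp, Finset.sum_range]
          simp
      · refine Convex.linear_image ?_ p
        intro y hy y' hy' a b ha hb hab
        refine ⟨fun k => ?_, fun i => ?_⟩
        · rw [map_add, map_smul, map_smul, hy.1 k, hy'.1 k, ← add_smul, hab, one_smul]
        · have h1 := hy.2 i
          have h2 := hy'.2 i
          simp only [Pi.add_apply, Pi.smul_apply, smul_eq_mul]
          positivity
  obtain ⟨d, g, Aeq, beq, A', b, p', h⟩ := ext_of_types L c p _ main
  exact ⟨d, g, _, Aeq, beq, A', b, p', by simp [ι], h⟩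

/-! ### Perfect hash families -/

theorem card_good (n l : ℕ) (f : Fin l → Fin n) (hf : Function.Injective f) :
    l.factorial * Fintype.card (Fin n → Fin l) ≤
      Fintype.card {h : Fin n → Fin l // Function.Injective (h ∘ f)} * l ^ l := by
  classical
  have h1 : l.factorial = Fintype.card (Equiv.Perm (Fin l)) := by simp [Fintype.card_perm]
  have h2 : l ^ l = Fintype.card (Fin l → Fin l) := by simp
  rw [h1, h2, ← Fintype.card_prod, ← Fintype.card_prod]
  have hext : ∀ (σ : Equiv.Perm (Fin l)) (h : Fin n → Fin l),
      Function.extend f σ h ∘ f = σ := by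
    intro σ h
    funext i
    simp [hf.extend_apply]
  refine Fintype.card_le_of_injective
    (fun x : Equiv.Perm (Fin l) × (Fin n → Fin l) =>
      ((⟨Function.extend f x.1 x.2, by rw [hext]; exact x.1.injective⟩ :
        {h : Fin n → Fin l // Function.Injective (h ∘ f)}), x.2 ∘ f)) ?_
  rintro ⟨σ, h⟩ ⟨σ', h'⟩ heq
  simp only [Prod.mk.injEq, Subtype.mk.injEq] at heq
  obtain ⟨ha, hb⟩ := heq
  have hσ : σ = σ' := by
    apply Equiv.coe_fn_injective
    show (σ : Fin l → Fin l) = σ'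
    rw [← hext σ h, ← hext σ' h', ha]
  have hh : h = h' := by
    funext v
    by_cases hv : ∃ i, f i = v
    · obtain ⟨i, rfl⟩ := hv
      exact congrFun hb i
    · have := congrFun ha v
      rwa [Function.extend_apply' _ _ _ hv, Function.extend_apply' _ _ _ hv] at this
  rw [hσ, hh]

theorem hash_exists_of_bound (n l q : ℕ) (hl : 0 < l) (hn : 0 < n)
    (hq : (l : ℝ) * Real.log n < q / 4 ^ l) :
    ∃ h : Fin q → Fin n → Fin l, ∀ f : Fin l → Fin n, Function.Injective f →
      ∃ k, Function.Injective (h k ∘ f) := by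
  classical
  by_contra hcon
  push Not at hcon
  -- every tuple is bad for some `f`
  choose F hF hbad using hcon
  let Bad : (Fin l → Fin n) → Type := fun f => {h : Fin n → Fin l // ¬ Function.Injective (h ∘ f)}
  let I := {f : Fin l → Fin n // Function.Injective f}
  have hN : (0 : ℝ) < Fintype.card (Fin n → Fin l) := by
    have : Nonempty (Fin l) := ⟨⟨0, hl⟩⟩
    exact_mod_cast Fintype.card_pos
  set N : ℝ := (Fintype.card (Fin n → Fin l) : ℝ) with hNdef
  have h1 : Fintype.card (Fin q → Fin n → Fin l) ≤ Fintype.card (Σ f : I, (Fin q → Bad f.1)) := by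
    refine Fintype.card_le_of_injective
      (fun h => ⟨⟨F h, hF h⟩, fun k => ⟨h k, hbad h k⟩⟩) ?_
    intro h h' heq
    have h3 := congrArg (fun x : (Σ f : I, (Fin q → Bad f.1)) => fun k => (x.2 k).1) heq
    exact h3
  have hp : ∀ f : I, (Fintype.card (Bad f.1) : ℝ) ≤ N * Real.exp (-(1 / 4 ^ l)) := by
    rintro ⟨f, hf⟩
    have hg := card_good n l f hf
    have hc := Fintype.card_subtype_compl (fun h : Fin n → Fin l => Function.Injective (h ∘ f))
    have hle := Fintype.card_subtype_le (fun h : Fin n → Fin l => Function.Injective (h ∘ f))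
    set G := Fintype.card {h : Fin n → Fin l // Function.Injective (h ∘ f)} with hG
    have hc' : (Fintype.card (Bad f) : ℝ) = N - G := by
      rw [hNdef, ← Nat.cast_sub hle]
      exact_mod_cast hc
    have hgR : (l.factorial : ℝ) * N ≤ G * (l : ℝ) ^ l := by
      rw [hNdef]; exact_mod_cast hg
    have hfac : (l : ℝ) ^ l ≤ 4 ^ l * l.factorial := by
      have h4 := Real.pow_div_factorial_le_exp (l : ℝ) (Nat.cast_nonneg l) l
      have h5 : Real.exp (l : ℝ) ≤ 4 ^ l := by
        have : Real.exp (l : ℝ) = Real.exp 1 ^ l := by rw [← Real.exp_nat_mul, mul_one]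
        rw [this]
        have := Real.exp_one_lt_d9
        gcongr
        linarith
      have hfp : (0 : ℝ) < l.factorial := by exact_mod_cast l.factorial_pos
      rw [div_le_iff₀ hfp] at h4
      calc (l : ℝ) ^ l ≤ Real.exp l * l.factorial := h4
        _ ≤ _ := by gcongr
    have hfp : (0 : ℝ) < l.factorial := by exact_mod_cast l.factorial_pos
    have hGN : N ≤ G * 4 ^ l := by
      have : (l.factorial : ℝ) * N ≤ l.factorial * (G * 4 ^ l) := by
        calc (l.factorial : ℝ) * N ≤ G * (l : ℝ) ^ l := hgR
          _ ≤ G * (4 ^ l * l.factorial) := by gcongr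
          _ = _ := by ring
      exact le_of_mul_le_mul_left this hfp
    have hGN' : N * (1 / 4 ^ l) ≤ G := by
      rw [mul_one_div, div_le_iff₀ (by positivity)]; exact hGN
    rw [hc']
    have := Real.one_sub_le_exp_neg (1 / 4 ^ l)
    calc N - G ≤ N * (1 - 1 / 4 ^ l) := by linarith
      _ ≤ _ := by gcongr
  have h2 : N ^ q ≤ (n : ℝ) ^ l * (N * Real.exp (-(1 / 4 ^ l))) ^ q := by
    have h1' : N ^ q ≤ ∑ f : I, (Fintype.card (Bad f.1) : ℝ) ^ q := by
      have h1'' := h1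
      rw [Fintype.card_sigma] at h1''
      simp only [Fintype.card_fun (α := Fin q), Fintype.card_fin q] at h1''
      rw [hNdef]
      exact_mod_cast h1''
    refine h1'.trans ?_
    calc ∑ f : I, (Fintype.card (Bad f.1) : ℝ) ^ q
        ≤ ∑ f : I, (N * Real.exp (-(1 / 4 ^ l))) ^ q := by
          refine Finset.sum_le_sum fun f _ => ?_
          exact pow_le_pow_left₀ (Nat.cast_nonneg _) (hp f) q
      _ = (Fintype.card I : ℝ) * (N * Real.exp (-(1 / 4 ^ l))) ^ q := by
          rw [Finset.sum_const, Finset.card_univ, nsmul_eq_mul]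
      _ ≤ _ := by
          have : Fintype.card I ≤ n ^ l := by
            refine (Fintype.card_subtype_le _).trans ?_
            simp
          have h' : (Fintype.card I : ℝ) ≤ (n : ℝ) ^ l := by exact_mod_cast this
          gcongr
  rw [mul_pow, mul_left_comm] at h2
  have h3 : 1 ≤ (n : ℝ) ^ l * Real.exp (-(1 / 4 ^ l)) ^ q := by
    have : N ^ q * 1 ≤ N ^ q * ((n : ℝ) ^ l * Real.exp (-(1 / 4 ^ l)) ^ q) := by simpa using h2
    exact le_of_mul_le_mul_left this (by positivity)
  have hnpos : (0 : ℝ) < n := by exact_mod_cast hn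
  have h4 : (n : ℝ) ^ l = Real.exp (l * Real.log n) := by
    rw [Real.exp_nat_mul, Real.exp_log hnpos]
  rw [h4, ← Real.exp_nat_mul, ← Real.exp_add] at h3
  have h5 := Real.one_le_exp_iff.1 h3
  have h6 : (q : ℝ) * -(1 / 4 ^ l) = -(q / 4 ^ l) := by ring
  rw [h6] at h5
  linarith

theorem hash_exists (n l : ℕ) (hl : 0 < l) (hn : 2 ≤ n) :
    ∃ (q : ℕ) (h : Fin q → Fin n → Fin l),
      (q : ℝ) ≤ 3 * (4 ^ l * l * Real.logb 2 n) ∧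
      ∀ f : Fin l → Fin n, Function.Injective f → ∃ k, Function.Injective (h k ∘ f) := by
  have hn' : (2 : ℝ) ≤ n := by exact_mod_cast hn
  have hlog0 : 0 ≤ Real.log n := Real.log_nonneg (by linarith)
  have hb1 : 1 ≤ Real.logb 2 n := by
    rw [Real.le_logb_iff_rpow_le (by norm_num) (by linarith)]
    simpa using hn'
  have hb2 : Real.log n ≤ Real.logb 2 n := by
    have h2 : Real.log 2 ≤ 1 := by have := Real.log_two_lt_d9; linarith
    have h2' : 0 < Real.log 2 := Real.log_pos (by norm_num)
    rw [Real.logb, le_div_iff₀ h2']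
    nlinarith
  set x : ℝ := 4 ^ l * (l * Real.log n) with hx
  have hx0 : 0 ≤ x := by positivity
  obtain ⟨h, hh⟩ := hash_exists_of_bound n l (⌊x⌋₊ + 1) hl (by omega) (by
    rw [lt_div_iff₀ (by positivity)]
    have := Nat.lt_floor_add_one x
    push_cast
    linarith)
  refine ⟨_, h, ?_, hh⟩
  have h1 : ((⌊x⌋₊ + 1 : ℕ) : ℝ) ≤ x + 1 := by
    push_cast
    have := Nat.floor_le hx0
    linarith
  refine h1.trans ?_
  have h2 : x ≤ 4 ^ l * l * Real.logb 2 n := by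
    rw [hx, ← mul_assoc]; gcongr
  have h3 : (1 : ℝ) ≤ 4 ^ l * l * Real.logb 2 n := by
    have h4 : (1 : ℝ) ≤ 4 ^ l := one_le_pow₀ (by norm_num)
    have h5 : (1 : ℝ) ≤ l := by exact_mod_cast hl
    have := mul_le_mul (mul_le_mul h4 h5 (by norm_num) (by positivity)) hb1 (by norm_num)
      (by positivity)
    linarith
  linarith

/-! ### Cycles -/

/-- The characteristic vector of a single edge. -/
def eVec {n : ℕ} (u v : Fin n) : Edge n → ℝ := fun e => if e.1 = s(u, v) then 1 else 0

theorem cycleVec_eq_sum {n T : ℕ} (hT : 1 ≤ T) (g : ℕ → Fin n)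
    (hg : Set.InjOn g (Set.Iio (T + 2))) :
    cycleVec (fun i : Fin (T + 2) => g i) =
      ∑ i ∈ Finset.range (T + 1), eVec (g i) (g (i + 1)) + eVec (g (T + 1)) (g 0) := by
  set f : Fin (T + 2) → Fin n := fun i => g i with hf
  have hfi : Function.Injective f := by
    intro i j hij
    exact Fin.ext (hg i.2 j.2 hij)
  have hinj : Function.Injective (fun i : Fin (T + 2) => s(f i, f (finRotate (T + 2) i))) := by
    intro i j hij
    simp only [Sym2.eq_iff] at hij
    rcases hij with ⟨h, -⟩ | ⟨h1, h2⟩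
    · exact hfi h
    · have h1 := hfi h1
      have h2 := hfi h2
      exfalso
      rw [← h2] at h1
      have h3 := congrArg Fin.val h1
      simp only [finRotate_apply] at h3
      rw [Fin.val_add_one, Fin.val_add_one] at h3
      simp only [Fin.ext_iff, Fin.val_last, Fin.val_add_one] at h3
      have := i.2
      split_ifs at h3 <;> omega
  have h1 : cycleVec f = ∑ i, eVec (f i) (f (finRotate (T + 2) i)) := by
    funext e
    rw [Finset.sum_apply]
    simp only [cycleVec, eVec]
    by_cases he : ∃ i, s(f i, f (finRotate (T + 2) i)) = e.1
    · obtain ⟨i, hi⟩ := he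
      rw [if_pos (Finset.mem_image.2 ⟨i, Finset.mem_univ _, hi⟩), Finset.sum_eq_single i]
      · rw [if_pos hi.symm]
      · intro j _ hj
        rw [if_neg]
        intro h
        exact hj (hinj (h.symm.trans hi.symm))
      · simp
    · rw [if_neg (by simpa using he), Finset.sum_eq_zero]
      intro j _
      rw [if_neg]
      intro h
      exact he ⟨j, h.symm⟩
  rw [h1, Fin.sum_univ_castSucc, Finset.sum_range, finRotate_last]
  congr 1
  refine Finset.sum_congr rfl fun i _ => ?_
  have : finRotate (T + 2) i.castSucc = ⟨i + 1, by omega⟩ := finRotate_of_lt i.2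
  rw [this]
  rfl

theorem cycle_ext {n T q : ℕ} (hT : 1 ≤ T) (h : Fin q → Fin n → Fin (T + 2))
    (hh : ∀ f : Fin (T + 2) → Fin n, Function.Injective f → ∃ k, Function.Injective (h k ∘ f)) :
    ∃ (d g f : ℕ) (Aeq : Fin g → Fin d → ℝ) (beq : Fin g → ℝ)
      (A' : Fin f → Fin d → ℝ) (b : Fin f → ℝ)
      (p : (Fin d → ℝ) →ᵃ[ℝ] (Edge n → ℝ)),
      f = (T + 1) * (q * (n * (2 ^ (T + 2) * (n * n)))) ∧
      p '' {y : Fin d → ℝ |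
        (∀ i : Fin g, ∑ j, Aeq i j * y j = beq i) ∧
        (∀ i : Fin f, ∑ j, A' i j * y j ≤ b i)} = cyclePolytope n (T + 2) := by
  classical
  let A := Fin q × Fin n × Finset (Fin (T + 2)) × Fin n × Fin n
  let S := Fin q × Fin n × Finset (Fin (T + 2)) × Fin n
  let src : A → S := fun a => (a.1, a.2.1, a.2.2.1, a.2.2.2.1)
  let tgt : A → S := fun a => (a.1, a.2.1, insert (h a.1 a.2.2.2.2) a.2.2.1, a.2.2.2.2)
  let W : ℕ → Fin n → Fin n → Fin n → (Edge n → ℝ) := fun i s u v =>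
    eVec u v + if i = T then eVec v s else 0
  let w : ℕ → A → (Edge n → ℝ) := fun t a => W t a.2.1 a.2.2.2.1 a.2.2.2.2
  let R : ℕ → S → Set (Edge n → ℝ) := fun t s => {x | ∃ g : ℕ → Fin n, g 0 = s.2.1 ∧
    g t = s.2.2.2 ∧ Set.InjOn (h s.1 ∘ g) (Set.Iio (t + 1)) ∧
    s.2.2.1 = Finset.image (h s.1 ∘ g) (Finset.range (t + 1)) ∧
    x = ∑ i ∈ Finset.range t, W i s.2.1 (g i) (g (i + 1))}
  let al : ℕ → A → Prop := fun t a => h a.1 a.2.2.2.2 ∉ a.2.2.1 ∧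
    (t = 0 → a.2.2.1 = {h a.1 a.2.1} ∧ a.2.2.2.1 = a.2.1)
  have hWsum : ∀ g : ℕ → Fin n, ∑ i ∈ Finset.range (T + 1), W i (g 0) (g i) (g (i + 1)) =
      ∑ i ∈ Finset.range (T + 1), eVec (g i) (g (i + 1)) + eVec (g (T + 1)) (g 0) := by
    intro g
    simp only [W]
    rw [Finset.sum_add_distrib, Finset.sum_ite_eq']
    simp
  have main := network_ext src tgt w R T al
    {x | ∃ f : Fin (T + 2) → Fin n, Function.Injective f ∧ x = cycleVec f} ?_ ?_ ?_ ?_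
  · obtain ⟨d, g, f, Aeq, beq, A', b, p, hf, hp⟩ := main
    refine ⟨d, g, f, Aeq, beq, A', b, p, ?_, hp⟩
    rw [hf]
    simp [A]
  · rintro ⟨k, s, C, u, v⟩ ⟨-, h2⟩
    obtain ⟨h3, h4⟩ := h2 rfl
    dsimp only at h3 h4
    subst h3 h4
    refine ⟨fun _ => u, rfl, rfl, ?_, ?_, by simp⟩
    · intro i hi j hj _
      simp only [Set.mem_Iio] at hi hj
      omega
    · simp [src]
  · rintro t ht ⟨k, s, C, u, v⟩ ⟨h1, -⟩ x ⟨g, hg0, hgt, hinj, hC, rfl⟩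
    dsimp only [src] at hg0 hgt hinj hC h1
    have hne : ∀ i ≤ t, Function.update g (t + 1) v i = g i := fun i hi =>
      Function.update_of_ne (by omega) _ _
    have hself : Function.update g (t + 1) v (t + 1) = v := Function.update_self _ _ _
    have hC' : C = Finset.image (h k ∘ Function.update g (t + 1) v) (Finset.range (t + 1)) := by
      rw [hC]
      refine Finset.image_congr fun i hi => ?_
      have hi : i < t + 1 := by simpa using hi
      simp only [Function.comp]
      rw [hne i (by omega)]
    refine ⟨Function.update g (t + 1) v, ?_, hself, ?_, ?_, ?_⟩
    · rw [hne 0 (by omega)]; exact hg0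
    · have hnot : ∀ i ≤ t, h k (g i) ≠ h k v := by
        intro i hi heq
        apply h1
        rw [hC, ← heq]
        exact Finset.mem_image.2 ⟨i, Finset.mem_range.2 (by omega), rfl⟩
      intro i hi j hj hij
      simp only [Set.mem_Iio] at hi hj
      dsimp only [tgt, Function.comp] at hij
      rcases Nat.lt_or_ge i (t + 1) with hi' | hi' <;> rcases Nat.lt_or_ge j (t + 1) with hj' | hj'
      · rw [hne i (by omega), hne j (by omega)] at hij
        exact hinj hi' hj' hij
      · obtain rfl : j = t + 1 := by omega
        rw [hne i (by omega), hself] at hij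
        exact absurd hij (hnot i (by omega))
      · obtain rfl : i = t + 1 := by omega
        rw [hne j (by omega), hself] at hij
        exact absurd hij.symm (hnot j (by omega))
      · omega
    · show insert (h k v) C = Finset.image (h k ∘ Function.update g (t + 1) v) _
      rw [Finset.range_add_one, Finset.image_insert, ← hC']
      simp only [Function.comp, hself]
    · rw [Finset.sum_range_succ, hne t le_rfl, hself, hgt]
      congr 1
      refine Finset.sum_congr rfl fun i hi => ?_
      have hi := Finset.mem_range.1 hi
      rw [hne i (by omega), hne (i + 1) (by omega)]
  · rintro ⟨k, s, C, u⟩ x ⟨g, hg0, hgt, hinj, hC, rfl⟩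
    dsimp only at hg0 hgt hinj hC
    have hg : Set.InjOn g (Set.Iio (T + 2)) := fun i hi j hj hij =>
      hinj hi hj (congrArg (h k) hij)
    refine ⟨fun i => g i, fun i j hij => Fin.ext (hg i.2 j.2 hij), ?_⟩
    rw [cycleVec_eq_sum hT g hg, ← hWsum, hg0]
  · rintro x ⟨f, hf, rfl⟩
    obtain ⟨k, hk⟩ := hh f hf
    let g : ℕ → Fin n := fun i => if hi : i < T + 2 then f ⟨i, hi⟩ else f 0
    have hgf : ∀ i (hi : i < T + 2), g i = f ⟨i, hi⟩ := fun i hi => dif_pos hi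
    have hkg : Set.InjOn (h k ∘ g) (Set.Iio (T + 2)) := by
      intro i hi j hj hij
      simp only [Function.comp, hgf i hi, hgf j hj] at hij
      exact congrArg Fin.val (hk hij)
    have hg : Set.InjOn g (Set.Iio (T + 2)) := fun i hi j hj hij =>
      hkg hi hj (congrArg (h k) hij)
    refine ⟨fun t => (k, g 0, Finset.image (h k ∘ g) (Finset.range (t + 1)), g t, g (t + 1)),
      ?_, ?_, ?_⟩
    · intro t ht
      refine ⟨?_, ?_⟩
      · intro hmem
        obtain ⟨i, hi, hie⟩ := Finset.mem_image.1 hmem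
        have hi := Finset.mem_range.1 hi
        have : i = t + 1 := hkg (Set.mem_Iio.2 (by omega)) (Set.mem_Iio.2 (by omega)) hie
        omega
      · rintro rfl
        simp
    · intro t ht
      simp only [src, tgt]
      rw [Finset.range_add_one (n := t + 1), Finset.image_insert]
      rfl
    · have : f = fun i : Fin (T + 2) => g i := by
        funext i
        rw [hgf i i.2]
      rw [this, cycleVec_eq_sum hT g hg, ← hWsum]

/-- Theorem 5.3.  There is a constant `C > 0` such that for all
`n ≥ 2` and `ℓ ≥ 3` the polytope `P_cycl(ℓ,n)` has an extension of size at most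
`2^{Cℓ}·n³·log₂ n`: a polyhedron `Q ⊆ ℝ^d` described by linear equations together with
`f ≤ 2^{Cℓ}·n³·log₂ n` linear inequalities, and an affine map `p` with
`p(Q) = P_cycl(ℓ,n)`. -/
theorem statement17 :
    ∃ C : ℝ, 0 < C ∧
      ∀ n ℓ : ℕ, 2 ≤ n → 3 ≤ ℓ →
        ∃ (d g f : ℕ) (Aeq : Fin g → Fin d → ℝ) (beq : Fin g → ℝ)
          (A : Fin f → Fin d → ℝ) (b : Fin f → ℝ)
          (p : (Fin d → ℝ) →ᵃ[ℝ] (Edge n → ℝ)),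
          (f : ℝ) ≤ (2 : ℝ) ^ (C * ℓ) * (n : ℝ) ^ 3 * Real.logb 2 (n : ℝ) ∧
          p '' {y : Fin d → ℝ |
              (∀ i : Fin g, ∑ j, Aeq i j * y j = beq i) ∧
              (∀ i : Fin f, ∑ j, A i j * y j ≤ b i)} = cyclePolytope n ℓ := by
  refine ⟨6, by norm_num, fun n l hn hl => ?_⟩
  obtain ⟨T, rfl⟩ : ∃ T, l = T + 2 := ⟨l - 2, by omega⟩
  obtain ⟨q, h, hq, hh⟩ := hash_exists n (T + 2) (by omega) hn
  obtain ⟨d, g, f, Aeq, beq, A, b, p, hf, hp⟩ := cycle_ext (by omega) h hh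
  refine ⟨d, g, f, Aeq, beq, A, b, p, ?_, hp⟩
  have hpow : (2 : ℝ) ^ ((6 : ℝ) * ((T + 2 : ℕ) : ℝ)) = (2 ^ (T + 2)) ^ 6 := by
    rw [← pow_mul, mul_comm (T + 2) 6, ← Real.rpow_natCast]
    push_cast
    rfl
  rw [hpow, hf]
  have hl2 : ((T + 2 : ℕ) : ℝ) ≤ 2 ^ (T + 2) := by
    exact_mod_cast (Nat.lt_two_pow_self (n := T + 2)).le
  have hT2 : ((T + 1 : ℕ) : ℝ) ≤ 2 ^ (T + 2) := by
    refine le_trans ?_ hl2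
    push_cast
    linarith
  have h3 : (3 : ℝ) ≤ 2 ^ (T + 2) := by
    refine le_trans ?_ hl2
    exact_mod_cast hl
  have h4 : (4 : ℝ) ^ (T + 2) = (2 ^ (T + 2)) ^ 2 := by
    rw [← pow_mul, mul_comm, pow_mul]; norm_num
  have hlog : 0 ≤ Real.logb 2 (n : ℝ) :=
    Real.logb_nonneg (by norm_num) (by exact_mod_cast (by omega : 1 ≤ n))
  rw [h4] at hq
  push_cast at hq hl2 hT2 ⊢
  set P : ℝ := 2 ^ (T + 2) with hP
  have hP0 : 0 ≤ P := by positivity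
  have hq' : (q : ℝ) ≤ P * (P ^ 2 * P * Real.logb 2 n) := by
    refine hq.trans ?_
    gcongr
  calc ((T : ℝ) + 1) * (q * (n * (P * (n * n))))
      ≤ P * ((P * (P ^ 2 * P * Real.logb 2 n)) * (n * (P * (n * n)))) := by gcongr
    _ = P ^ 6 * (n : ℝ) ^ 3 * Real.logb 2 n := by ring

end
end
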